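/- arXiv:2506.20820 — 4 statements merged into one kernel-verified Lean document; each statement's English description precedes it below -/
import Mathlib

section
/- Let s ≡ 1 (mod 4) be square-free with s > 7 and 7 ∤ s such that 7s > s (automatic), and let K = Q(√7, √s). Then the element α = 1² + 1² + 1² + (1+√7)² + ((1+√s)/2)² + (1+(1+√s)/2)² of O_K cannot be written as a sum of 5 or fewer squares of elements of O_K; hence the Pythagoras number of O_K is at least 6. -/
open scoped Classical

noncomputable section

/-- `α` is a sum of `n` squares of elements of `S ⊆ ℝ`. -/
def SumOfSquaresLen (S : Set ℝ) (n : ℕ) (α : ℝ) : Prop :=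
  ∃ x : Fin n → ℝ, (∀ i, x i ∈ S) ∧ α = ∑ i, x i ^ 2

/-- The length of `α` as a sum of squares of elements of `S` (∞ if not a sum of squares). -/
def sqLength (S : Set ℝ) (α : ℝ) : ℕ∞ :=
  sInf {n : ℕ∞ | ∃ k : ℕ, n = (k : ℕ∞) ∧ SumOfSquaresLen S k α}

/-- The Pythagoras number of `S ⊆ ℝ`. -/
def pythagorasNumber (S : Set ℝ) : ℕ∞ :=
  sSup {n : ℕ∞ | ∃ α : ℝ, (∃ k : ℕ, SumOfSquaresLen S k α) ∧ n = sqLength S α}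

/-- The biquadratic field `ℚ(√p, √q)` as a subfield of `ℝ`. -/
def biquadField (p q : ℝ) : IntermediateField ℚ ℝ :=
  IntermediateField.adjoin ℚ {Real.sqrt p, Real.sqrt q}

/-- The ring of integers of `ℚ(√p, √q)`, viewed as a subset of `ℝ`. -/
def ringOfInt (p q : ℝ) : Set ℝ :=
  {x : ℝ | x ∈ biquadField p q ∧ IsIntegral ℤ x}

/-- If `n` is squarefree and `n q²` is an integer then `q` is an integer. -/
lemma rat_int_of_sqfree (n : ℕ) (hn : Squarefree n) (q : ℚ) (k : ℤ) (h : n * q ^ 2 = k) :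
    ∃ r : ℤ, q = r := by
  have hd : (q.den : ℚ) ≠ 0 := by exact_mod_cast q.den_nz
  have h1 : (n : ℤ) * q.num ^ 2 = k * (q.den : ℤ) ^ 2 := by
    have h2 : (n : ℚ) * q.num ^ 2 = k * (q.den : ℚ) ^ 2 := by
      rw [← h]
      nth_rewrite 2 [← Rat.num_div_den q]
      field_simp
    exact_mod_cast h2
  have h3 : ((q.den : ℤ)) ^ 2 ∣ (n : ℤ) * q.num ^ 2 := ⟨k, by rw [h1]; ring⟩
  have hc : IsCoprime ((q.den : ℤ) ^ 2) (q.num ^ 2) := by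
    apply IsCoprime.pow
    rw [Int.isCoprime_iff_gcd_eq_one, Int.gcd_comm]
    exact q.reduced
  have h4 : (q.den : ℤ) ^ 2 ∣ (n : ℤ) := hc.dvd_of_dvd_mul_right h3
  have h5 : q.den * q.den ∣ n := by
    have : ((q.den * q.den : ℕ) : ℤ) ∣ (n : ℤ) := by push_cast; rwa [← sq]
    exact_mod_cast this
  have h6 : q.den = 1 := by simpa using hn _ h5
  exact ⟨q.num, ((Rat.den_eq_one_iff q).1 h6).symm⟩

/-- Integers of `ℚ(√n)` for `n ≡ 3 (mod 4)`. -/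
lemma quad_int (n : ℕ) (hn : Squarefree n) (hn4 : n % 4 = 3) (P Q : ℚ) (m k : ℤ)
    (h1 : 2 * P = m) (h2 : P ^ 2 - n * Q ^ 2 = k) : (∃ r : ℤ, P = r) ∧ (∃ r : ℤ, Q = r) := by
  obtain ⟨r, hr⟩ := rat_int_of_sqfree n hn (2 * Q) (m ^ 2 - 4 * k) (by
    push_cast; rw [← h1, ← h2]; ring)
  have h3 : m ^ 2 - n * r ^ 2 = 4 * k := by
    have : (m : ℚ) ^ 2 - n * r ^ 2 = 4 * k := by rw [← h1, ← h2, ← hr]; ring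
    exact_mod_cast this
  obtain ⟨t, ht⟩ : ∃ t : ℤ, (n : ℤ) = 4 * t + 3 := ⟨n / 4, by omega⟩
  rw [ht] at h3
  have key : m % 2 = 0 ∧ r % 2 = 0 := by
    rcases Int.even_or_odd' m with ⟨a, ha | ha⟩ <;> rcases Int.even_or_odd' r with ⟨b, hb | hb⟩ <;>
      subst ha <;> subst hb
    · omega
    · ring_nf at h3; omega
    · ring_nf at h3; omega
    · ring_nf at h3; omega
  refine ⟨⟨m / 2, ?_⟩, ⟨r / 2, ?_⟩⟩
  · have : (m : ℚ) = 2 * ((m / 2 : ℤ) : ℚ) := by exact_mod_cast (by omega : m = 2 * (m / 2))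
    linarith
  · have : (r : ℚ) = 2 * ((r / 2 : ℤ) : ℚ) := by exact_mod_cast (by omega : r = 2 * (r / 2))
    linarith

/-- The field `ℚ(√7)`, as a quadratic algebra. -/
abbrev F7 := QuadraticAlgebra ℚ 7 0

/-- The field `ℚ(√7, √s)`, as a quadratic algebra. -/
abbrev L7 (s : ℕ) := QuadraticAlgebra F7 (s : F7) 0

lemma sqfree_ne_sq (n : ℕ) (hn : Squarefree n) (h1 : n ≠ 1) (q : ℚ) : q ^ 2 ≠ n := by
  intro h
  obtain ⟨r, hr⟩ := rat_int_of_sqfree 1 squarefree_one q n (by simpa using h)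
  have h2 : r ^ 2 = (n : ℤ) := by
    have : (r : ℚ) ^ 2 = n := by rw [← hr, h]
    exact_mod_cast this
  have h3 : r.natAbs * r.natAbs = n := by
    zify
    rw [← h2, ← sq, sq_abs]
  have := hn r.natAbs ⟨1, by omega⟩
  rw [Nat.isUnit_iff] at this
  rw [this] at h3
  omega

instance fact7 : Fact (∀ r : ℚ, r ^ 2 ≠ 7 + 0 * r) := ⟨fun r h => by
  refine sqfree_ne_sq 7 (Nat.Prime.prime (by norm_num : Nat.Prime 7)).squarefree (by norm_num) r ?_
  rw [h]; norm_num⟩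

lemma sq7s (s : ℕ) (hsf : Squarefree s) (h7 : ¬ 7 ∣ s) : Squarefree (7 * s) := by
  rw [Nat.squarefree_mul ((Nat.Prime.coprime_iff_not_dvd (by norm_num)).2 h7)]
  exact ⟨(Nat.Prime.prime (by norm_num : Nat.Prime 7)).squarefree, hsf⟩

lemma facts (s : ℕ) (hsf : Squarefree s) (hs7 : 7 < s) (h7 : ¬ 7 ∣ s) :
    Fact (∀ r : F7, r ^ 2 ≠ (s : F7) + 0 * r) := ⟨fun r h => by
  have h1 := congrArg QuadraticAlgebra.re h
  have h2 := congrArg QuadraticAlgebra.im h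
  simp [sq] at h1 h2
  have h3 : r.re * r.im = 0 := by linarith
  rcases mul_eq_zero.1 h3 with h4 | h4
  · rw [h4] at h1
    refine sqfree_ne_sq (7 * s) (sq7s s hsf h7) (by omega) (7 * r.im) ?_
    push_cast; rw [← h1]; ring
  · rw [h4] at h1
    refine sqfree_ne_sq s hsf (by omega) r.re ?_
    rw [← h1]; ring⟩

/-- The ring homomorphisms from `L7 s` to `ℝ`. -/
def toR (s : ℕ) (u v : ℝ) (hu : u * u = 7) (hv : v * v = s) : L7 s →+* ℝ where
  toFun z := z.re.re + z.re.im * u + (z.im.re + z.im.im * u) * v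
  map_zero' := by simp
  map_one' := by simp [QuadraticAlgebra.re_one, QuadraticAlgebra.im_one]
  map_add' z w := by simp; ring
  map_mul' z w := by
    simp
    linear_combination (-(z.re.im * w.re.im : ℝ) - z.im.im * w.im.im * s - z.re.im * w.im.im * v
      - z.im.im * w.re.im * v) * hu - ((z.im.re + z.im.im * u) * (w.im.re + w.im.im * u) : ℝ) * hv

lemma int_rat (q : ℚ) (h : IsIntegral ℤ (q : ℝ)) : ∃ k : ℤ, q = k := by
  have h1 : IsIntegral ℤ q := by
    have := (isIntegral_algHom_iff (Rat.castHom ℝ).toIntAlgHom (Rat.castHom ℝ).injective (x := q)).1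
    exact this h
  obtain ⟨k, hk⟩ := IsIntegrallyClosed.isIntegral_iff.1 h1
  exact ⟨k, by simpa using hk.symm⟩

lemma int_rat' (q : ℚ) (y : ℝ) (hy : IsIntegral ℤ y) (h : (q : ℝ) = y) : ∃ k : ℤ, q = k :=
  int_rat q (h ▸ hy)

lemma indep (s : ℕ) (hsf : Squarefree s) (hs7 : 7 < s) (h7 : ¬ 7 ∣ s) (a b c d : ℚ)
    (h : (a + b * √7 + (c + d * √7) * √s : ℝ) = 0) : a = 0 ∧ b = 0 ∧ c = 0 ∧ d = 0 := by
  have := facts s hsf hs7 h7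
  have hi := (toR s √7 √s (by simp) (by simp)).injective
  have : (⟨⟨a, b⟩, ⟨c, d⟩⟩ : L7 s) = 0 := by
    apply hi
    rw [map_zero]
    exact h
  have h1 := congrArg QuadraticAlgebra.re this
  have h2 := congrArg QuadraticAlgebra.im this
  have h3 := congrArg QuadraticAlgebra.re h1
  have h4 := congrArg QuadraticAlgebra.im h1
  have h5 := congrArg QuadraticAlgebra.re h2
  have h6 := congrArg QuadraticAlgebra.im h2
  exact ⟨h3, h4, h5, h6⟩

lemma coords_rat (s : ℕ) (hsf : Squarefree s) (hs7 : 7 < s) (h7 : ¬ 7 ∣ s) (x : ℝ)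
    (hx : x ∈ ringOfInt 7 s) : ∃ a b c d : ℚ, x = a + b * √7 + (c + d * √7) * √s ∧
      ∀ u v : ℝ, u * u = 7 → v * v = s → IsIntegral ℤ (a + b * u + (c + d * u) * v : ℝ) := by
  have := facts s hsf hs7 h7
  obtain ⟨hx1, hx2⟩ := hx
  set f := toR s √7 √s (by simp) (by simp) with hf
  have hle : biquadField 7 s ≤ f.toRatAlgHom.fieldRange := by
    apply IntermediateField.adjoin_le_iff.2
    rintro y (rfl | rfl)
    · exact ⟨⟨⟨0, 1⟩, ⟨0, 0⟩⟩, by simp [hf, toR]⟩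
    · exact ⟨⟨⟨0, 0⟩, ⟨1, 0⟩⟩, by simp [hf, toR]⟩
  obtain ⟨z, hz⟩ := hle hx1
  have hz' : f z = x := hz
  have hzi : IsIntegral ℤ z := by
    have := (isIntegral_algHom_iff f.toIntAlgHom f.injective (x := z)).1
    apply this
    show IsIntegral ℤ (f z)
    rw [hz']; exact hx2
  refine ⟨z.re.re, z.re.im, z.im.re, z.im.im, hz'.symm, fun u v hu hv => ?_⟩
  exact hzi.map (toR s u v hu hv).toIntAlgHom

lemma coords (s : ℕ) (hs4 : s % 4 = 1) (hsf : Squarefree s) (hs7 : 7 < s) (h7 : ¬ 7 ∣ s) (x : ℝ)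
    (hx : x ∈ ringOfInt 7 s) : ∃ A B C D : ℤ, 2 * x = A + B * √7 + (C + D * √7) * √s ∧
      A % 2 = C % 2 ∧ B % 2 = D % 2 := by
  obtain ⟨a, b, c, d, rfl, H⟩ := coords_rat s hsf hs7 h7 x hx
  set u : ℝ := √7 with hu'
  set v : ℝ := √(s : ℝ) with hv'
  have hu : u * u = 7 := by simp [hu']
  have hv : v * v = s := by simp [hv']
  have h1 := H u v hu hv
  have h2 := H (-u) v (by linarith) hv
  have h3 := H u (-v) hu (by linarith)
  have h4 := H (-u) (-v) (by linarith) (by linarith)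
  obtain ⟨m, hm⟩ := int_rat' (2 * (2 * a)) _ (((h1.add h2).add h3).add h4) (by
    push_cast
    ring)
  have s7 : Squarefree 7 := (Nat.Prime.prime (by norm_num : Nat.Prime 7)).squarefree
  obtain ⟨k1, hk1⟩ := int_rat' ((2 * a) ^ 2 - (7 : ℕ) * (2 * b) ^ 2) _ ((h1.add h3).mul (h2.add h4)) (by
    push_cast
    linear_combination (4 * (b : ℝ) ^ 2) * hu)
  obtain ⟨⟨A, hA⟩, ⟨B, hB⟩⟩ := quad_int 7 s7 (by norm_num) _ _ _ _ hm hk1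
  obtain ⟨k2, hk2⟩ := int_rat' ((2 * a) ^ 2 - (7 * s : ℕ) * (2 * d) ^ 2) _ ((h1.add h4).mul (h2.add h3)) (by
    push_cast
    linear_combination (4 * (d : ℝ) ^ 2 * v * v) * hu + (4 * (d : ℝ) ^ 2 * 7) * hv)
  obtain ⟨-, ⟨D, hD⟩⟩ := quad_int (7 * s) (sq7s s hsf h7) (by omega) _ _ _ _ hm hk2
  obtain ⟨k3, hk3⟩ := int_rat' ((2 * a) ^ 2 - s * (2 * c) ^ 2) _ ((h1.add h2).mul (h3.add h4)) (by
    push_cast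
    linear_combination (4 * (c : ℝ) ^ 2) * hv)
  obtain ⟨C, hC⟩ := rat_int_of_sqfree s hsf (2 * c) (A ^ 2 - k3) (by
    push_cast; rw [← hA, ← hk3]; ring)
  -- relative norm
  have n1 := h1.mul h3
  have n2 := h2.mul h4
  set P : ℚ := a ^ 2 + 7 * b ^ 2 - s * (c ^ 2 + 7 * d ^ 2) with hP
  set Q : ℚ := 2 * (a * b - s * c * d) with hQ
  have e1 : ((a + b * u + (c + d * u) * v) * (a + b * u + (c + d * u) * -v) : ℝ) = P + Q * u := by
    rw [hP, hQ]; push_cast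
    linear_combination ((b : ℝ) ^ 2 - s * d ^ 2) * hu - ((c + d * u) ^ 2 : ℝ) * hv
  have e2 : ((a + b * -u + (c + d * -u) * v) * (a + b * -u + (c + d * -u) * -v) : ℝ)
      = P - Q * u := by
    rw [hP, hQ]; push_cast
    linear_combination ((b : ℝ) ^ 2 - s * d ^ 2) * hu - ((c - d * u) ^ 2 : ℝ) * hv
  rw [e1] at n1
  rw [e2] at n2
  obtain ⟨m', hm'⟩ := int_rat' (2 * P) _ (n1.add n2) (by
    push_cast
    ring)
  obtain ⟨k', hk'⟩ := int_rat' (P ^ 2 - (7 : ℕ) * Q ^ 2) _ (n1.mul n2) (by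
    push_cast
    linear_combination ((Q : ℝ) ^ 2) * hu)
  obtain ⟨⟨p, hp⟩, ⟨q, hq⟩⟩ := quad_int 7 s7 (by norm_num) _ _ _ _ hm' hk'
  have E1 : A ^ 2 + 7 * B ^ 2 - s * (C ^ 2 + 7 * D ^ 2) = 4 * p := by
    have : (A : ℚ) ^ 2 + 7 * B ^ 2 - s * (C ^ 2 + 7 * D ^ 2) = 4 * p := by
      rw [← hA, ← hB, ← hC, ← hD, ← hp, hP]; ring
    exact_mod_cast this
  have E2 : A * B - s * C * D = 2 * q := by
    have : (A : ℚ) * B - s * C * D = 2 * q := by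
      rw [← hA, ← hB, ← hC, ← hD, ← hq, hQ]; ring
    exact_mod_cast this
  refine ⟨A, B, C, D, ?_, ?_⟩
  · have hA' : (A : ℝ) = 2 * a := by exact_mod_cast hA.symm
    have hB' : (B : ℝ) = 2 * b := by exact_mod_cast hB.symm
    have hC' : (C : ℝ) = 2 * c := by exact_mod_cast hC.symm
    have hD' : (D : ℝ) = 2 * d := by exact_mod_cast hD.symm
    rw [hA', hB', hC', hD']; ring
  · obtain ⟨t, ht⟩ : ∃ t : ℤ, (s : ℤ) = 4 * t + 1 := ⟨s / 4, by omega⟩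
    rw [ht] at E1 E2
    clear * - E1 E2
    rcases Int.even_or_odd' A with ⟨a, rfl | rfl⟩ <;>
    rcases Int.even_or_odd' B with ⟨b, rfl | rfl⟩ <;>
    rcases Int.even_or_odd' C with ⟨c, rfl | rfl⟩ <;>
    rcases Int.even_or_odd' D with ⟨d, rfl | rfl⟩ <;>
    first
    | omega
    | (exfalso; ring_nf at E1; omega)
    | (exfalso; ring_nf at E2; omega)

lemma fin_aux (x y z w c d : ℤ) (hc : c * c = 1) (hd : d * d = 1) (h : c * x + d * y = 4)
    (hx : x % 2 = 1) (_hy : y % 2 = 1) (hz : z % 2 = 0) (hw : w % 2 = 0)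
    (hs : x ^ 2 + y ^ 2 + z ^ 2 + w ^ 2 = 22) : False := by
  have hx' : (c * x - 2) ^ 2 ≤ 7 := by
    have h1 : (c * x) ^ 2 + (d * y) ^ 2 = x ^ 2 + y ^ 2 := by
      linear_combination x ^ 2 * hc + y ^ 2 * hd
    have : d * y = 4 - c * x := by linarith
    rw [this] at h1
    nlinarith [sq_nonneg z, sq_nonneg w]
  have h2 : x ^ 2 + y ^ 2 = 10 := by
    have h1 : (c * x) ^ 2 + (d * y) ^ 2 = x ^ 2 + y ^ 2 := by
      linear_combination x ^ 2 * hc + y ^ 2 * hd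
    rw [← h1]
    have h3 : (c * x) % 2 = 1 := by
      have : c % 2 = 1 := by
        rcases Int.even_or_odd' c with ⟨k, rfl | rfl⟩
        · ring_nf at hc; omega
        · omega
      rw [Int.mul_emod, this, hx]; rfl
    have h5 : d * y = 4 - c * x := by linarith
    rw [h5]
    generalize c * x = e at *
    have : -1 < e := by nlinarith
    have : e < 5 := by nlinarith
    interval_cases e <;> simp_all
  obtain ⟨p, rfl⟩ : ∃ p, z = 2 * p := ⟨z / 2, by omega⟩
  obtain ⟨q, rfl⟩ : ∃ p, w = 2 * p := ⟨w / 2, by omega⟩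
  have h6 : p ^ 2 + q ^ 2 = 3 := by nlinarith
  have : -2 < p := by nlinarith
  have : p < 2 := by nlinarith
  have : -2 < q := by nlinarith
  have : q < 2 := by nlinarith
  interval_cases p <;> interval_cases q <;> simp_all

lemma fin4 (A1 A2 A3 A4 C1 C2 C3 C4 : ℤ) (hC : C1 ^ 2 + C2 ^ 2 + C3 ^ 2 + C4 ^ 2 = 2)
    (hA : A1 ^ 2 + A2 ^ 2 + A3 ^ 2 + A4 ^ 2 = 22)
    (hAC : A1 * C1 + A2 * C2 + A3 * C3 + A4 * C4 = 4)
    (p1 : A1 % 2 = C1 % 2) (p2 : A2 % 2 = C2 % 2) (p3 : A3 % 2 = C3 % 2)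
    (p4 : A4 % 2 = C4 % 2) : False := by
  have : -2 < C1 := by nlinarith
  have : C1 < 2 := by nlinarith
  have : -2 < C2 := by nlinarith
  have : C2 < 2 := by nlinarith
  have : -2 < C3 := by nlinarith
  have : C3 < 2 := by nlinarith
  have : -2 < C4 := by nlinarith
  have : C4 < 2 := by nlinarith
  have k12 := fin_aux A1 A2 A3 A4 C1 C2
  have k13 := fin_aux A1 A3 A2 A4 C1 C3
  have k14 := fin_aux A1 A4 A2 A3 C1 C4
  have k23 := fin_aux A2 A3 A1 A4 C2 C3
  have k24 := fin_aux A2 A4 A1 A3 C2 C4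
  have k34 := fin_aux A3 A4 A1 A2 C3 C4
  interval_cases C1 <;> interval_cases C2 <;> interval_cases C3 <;> interval_cases C4 <;>
  first
  | (exfalso; revert hC; norm_num; done)
  | exact k12 (by norm_num) (by norm_num) (by linarith) (by omega) (by omega) (by omega) (by omega) (by linarith)
  | exact k13 (by norm_num) (by norm_num) (by linarith) (by omega) (by omega) (by omega) (by omega) (by linarith)
  | exact k14 (by norm_num) (by norm_num) (by linarith) (by omega) (by omega) (by omega) (by omega) (by linarith)
  | exact k23 (by norm_num) (by norm_num) (by linarith) (by omega) (by omega) (by omega) (by omega) (by linarith)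
  | exact k24 (by norm_num) (by norm_num) (by linarith) (by omega) (by omega) (by omega) (by omega) (by linarith)
  | exact k34 (by norm_num) (by norm_num) (by linarith) (by omega) (by omega) (by omega) (by omega) (by linarith)

lemma fin5_zero (A b C : Fin 5 → ℤ) (hA : ∑ i, A i ^ 2 = 26) (hb : ∑ i, b i ^ 2 = 1)
    (hC : ∑ i, C i ^ 2 = 2) (hAb : ∑ i, A i * b i = 2) (hAC : ∑ i, A i * C i = 4)
    (hbC : ∑ i, b i * C i = 0) (hp : ∀ i, A i % 2 = C i % 2) (h0 : b 0 ≠ 0) : False := by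
  simp only [Fin.sum_univ_five] at *
  have hb0 : 1 ≤ b 0 ^ 2 := by have := sq_pos_of_ne_zero h0; omega
  have z1 : b 1 = 0 := pow_eq_zero_iff (two_ne_zero) |>.1 (by nlinarith [sq_nonneg (b 1), sq_nonneg (b 2), sq_nonneg (b 3), sq_nonneg (b 4)])
  have z2 : b 2 = 0 := pow_eq_zero_iff (two_ne_zero) |>.1 (by nlinarith [sq_nonneg (b 1), sq_nonneg (b 2), sq_nonneg (b 3), sq_nonneg (b 4)])
  have z3 : b 3 = 0 := pow_eq_zero_iff (two_ne_zero) |>.1 (by nlinarith [sq_nonneg (b 1), sq_nonneg (b 2), sq_nonneg (b 3), sq_nonneg (b 4)])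
  have z4 : b 4 = 0 := pow_eq_zero_iff (two_ne_zero) |>.1 (by nlinarith [sq_nonneg (b 1), sq_nonneg (b 2), sq_nonneg (b 3), sq_nonneg (b 4)])
  rw [z1, z2, z3, z4] at hb hAb hbC
  simp only [mul_zero, zero_mul, add_zero] at hAb hbC
  have hC0 : C 0 = 0 := (mul_eq_zero.1 hbC).resolve_left h0
  have hb1 : b 0 ^ 2 = 1 := by linarith
  have hA0 : A 0 ^ 2 = 4 := by
    have : (A 0 * b 0) ^ 2 = 4 := by rw [hAb]; norm_num
    rwa [mul_pow, hb1, mul_one] at this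
  rw [hC0] at hC hAC
  exact fin4 (A 1) (A 2) (A 3) (A 4) (C 1) (C 2) (C 3) (C 4) (by linarith) (by linarith)
    (by linarith) (hp 1) (hp 2) (hp 3) (hp 4)

lemma fin5 (A b C : Fin 5 → ℤ) (hA : ∑ i, A i ^ 2 = 26) (hb : ∑ i, b i ^ 2 = 1)
    (hC : ∑ i, C i ^ 2 = 2) (hAb : ∑ i, A i * b i = 2) (hAC : ∑ i, A i * C i = 4)
    (hbC : ∑ i, b i * C i = 0) (hp : ∀ i, A i % 2 = C i % 2) : False := by
  obtain ⟨j, hj⟩ : ∃ j, b j ≠ 0 := by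
    by_contra! h
    simp [h] at hb
  let e : Equiv.Perm (Fin 5) := Equiv.swap 0 j
  refine fin5_zero (A ∘ e) (b ∘ e) (C ∘ e) ?_ ?_ ?_ ?_ ?_ ?_ (fun i => hp _) (by simpa [e] using hj)
  · rw [← hA]; exact Equiv.sum_comp e (fun i => A i ^ 2)
  · rw [← hb]; exact Equiv.sum_comp e (fun i => b i ^ 2)
  · rw [← hC]; exact Equiv.sum_comp e (fun i => C i ^ 2)
  · rw [← hAb]; exact Equiv.sum_comp e (fun i => A i * b i)
  · rw [← hAC]; exact Equiv.sum_comp e (fun i => A i * C i)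
  · rw [← hbC]; exact Equiv.sum_comp e (fun i => b i * C i)

/-- The arithmetic core. -/
lemma core (s : ℕ) (hs13 : 13 ≤ s) (A B C D : Fin 5 → ℤ)
    (hAC : ∀ i, A i % 2 = C i % 2) (hBD : ∀ i, B i % 2 = D i % 2)
    (h1 : ∑ i, (A i ^ 2 + 7 * B i ^ 2 + s * C i ^ 2 + 7 * s * D i ^ 2) = 54 + 2 * (s : ℤ))
    (h2 : ∑ i, (A i * B i + s * (C i * D i)) = 4)
    (h3 : ∑ i, (A i * C i + 7 * (B i * D i)) = 4)
    (h4 : ∑ i, (A i * D i + B i * C i) = 0) : False := by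
  have hs : (13 : ℤ) ≤ s := by exact_mod_cast hs13
  simp only [Finset.sum_add_distrib, ← Finset.mul_sum] at h1 h2 h3 h4
  have nA : 0 ≤ ∑ i, A i ^ 2 := Finset.sum_nonneg fun i _ => sq_nonneg _
  have nB : 0 ≤ ∑ i, B i ^ 2 := Finset.sum_nonneg fun i _ => sq_nonneg _
  have nC : 0 ≤ ∑ i, C i ^ 2 := Finset.sum_nonneg fun i _ => sq_nonneg _
  have nD : 0 ≤ ∑ i, D i ^ 2 := Finset.sum_nonneg fun i _ => sq_nonneg _
  have hD0 : ∑ i, D i ^ 2 = 0 := by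
    by_contra hne
    have : 1 ≤ ∑ i, D i ^ 2 := by omega
    nlinarith
  have hD : ∀ i, D i = 0 := fun i => by
    have := (Finset.sum_eq_zero_iff_of_nonneg (fun i _ => sq_nonneg (D i))).1 hD0 i (Finset.mem_univ _)
    exact pow_eq_zero_iff two_ne_zero |>.1 this
  obtain ⟨b, hb⟩ : ∃ b : Fin 5 → ℤ, ∀ i, B i = 2 * b i :=
    ⟨fun i => B i / 2, fun i => by have := hBD i; rw [hD i] at this; show B i = 2 * (B i / 2); omega⟩
  obtain rfl : B = fun i => 2 * b i := funext hb
  have nb : 0 ≤ ∑ i, b i ^ 2 := Finset.sum_nonneg fun i _ => sq_nonneg _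
  have eB : ∑ i, (2 * b i) ^ 2 = 4 * ∑ i, b i ^ 2 := by
    rw [Finset.mul_sum]; exact Finset.sum_congr rfl fun i _ => by ring
  have eAB : ∑ i, A i * (2 * b i) = 2 * ∑ i, A i * b i := by
    rw [Finset.mul_sum]; exact Finset.sum_congr rfl fun i _ => by ring
  have eBC : ∑ i, 2 * b i * C i = 2 * ∑ i, b i * C i := by
    rw [Finset.mul_sum]; exact Finset.sum_congr rfl fun i _ => by ring
  simp only [hD, mul_zero, Finset.sum_const_zero, add_zero, zero_add, eBC] at h2 h3 h4
  rw [eB, hD0] at h1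
  rw [eAB] at h2
  have hpar : (∑ i, C i ^ 2) % 2 = 0 := by
    have : (∑ i, A i * C i) % 2 = (∑ i, C i ^ 2) % 2 := by
      apply Finset.sum_int_mod _ _ _ |>.trans
      rw [Finset.sum_int_mod (f := fun i => C i ^ 2)]
      congr 1
      refine Finset.sum_congr rfl fun i _ => ?_
      rw [Int.mul_emod, hAC i, ← Int.mul_emod, sq]
    rw [h3] at this
    omega
  have hb1 : 1 ≤ ∑ i, b i ^ 2 := by
    by_contra hne
    have h0 : ∑ i, b i ^ 2 = 0 := by omega
    have hz : ∀ i, b i = 0 := fun i => by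
      have := (Finset.sum_eq_zero_iff_of_nonneg (fun i _ => sq_nonneg (b i))).1 h0 i (Finset.mem_univ _)
      exact pow_eq_zero_iff two_ne_zero |>.1 this
    simp [hz] at h2
  have hC1 : ∑ i, C i ^ 2 ≠ 0 := by
    intro h0
    have hz : ∀ i, C i = 0 := fun i => by
      have := (Finset.sum_eq_zero_iff_of_nonneg (fun i _ => sq_nonneg (C i))).1 h0 i (Finset.mem_univ _)
      exact pow_eq_zero_iff two_ne_zero |>.1 this
    simp [hz] at h3
  have hC4 : ∑ i, C i ^ 2 < 5 := by
    by_contra hne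
    have : 5 ≤ ∑ i, C i ^ 2 := by omega
    nlinarith
  have hC2 : ∑ i, C i ^ 2 = 2 := by
    by_contra hne
    have h5 : ∑ i, C i ^ 2 = 4 := by omega
    rw [h5] at h1
    have h0 : ∑ i, A i ^ 2 = 0 := by linarith
    have hz : ∀ i, A i = 0 := fun i => by
      have := (Finset.sum_eq_zero_iff_of_nonneg (fun i _ => sq_nonneg (A i))).1 h0 i (Finset.mem_univ _)
      exact pow_eq_zero_iff two_ne_zero |>.1 this
    simp [hz] at h3
  rw [hC2] at h1
  have hbb : ∑ i, b i ^ 2 = 1 := by omega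
  exact fin5 A b C (by rw [hbb] at h1; linarith) hbb hC2 (by omega) h3 (by omega) hAC

lemma sum_split (f g h k : Fin 5 → ℝ) (u v : ℝ) :
    ∑ i, (f i + 2 * g i * u + (2 * h i + 2 * k i * u) * v) =
      ∑ i, f i + 2 * (∑ i, g i) * u + (2 * ∑ i, h i + 2 * (∑ i, k i) * u) * v := by
  simp only [Finset.sum_add_distrib, add_mul, Finset.mul_sum, Finset.sum_mul]

lemma part1 (s : ℕ) (hs4 : s % 4 = 1) (hsf : Squarefree s)
    (hs7 : 7 < s) (h7 : ¬ (7 ∣ s)) (x : Fin 5 → ℝ) (hx : ∀ i, x i ∈ ringOfInt 7 (s : ℝ))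
    (h : ((1 : ℝ) ^ 2 + 1 ^ 2 + 1 ^ 2 + (1 + Real.sqrt 7) ^ 2
          + ((1 + Real.sqrt s) / 2) ^ 2 + (1 + (1 + Real.sqrt s) / 2) ^ 2) = ∑ i, x i ^ 2) :
    False := by
  have hs13 : 13 ≤ s := by
    by_contra hne
    have : s = 9 := by omega
    subst this
    have := hsf 3 ⟨1, by norm_num⟩
    rw [Nat.isUnit_iff] at this
    omega
  choose A B C D hABCD hAC hBD using fun i => coords s hs4 hsf hs7 h7 (x i) (hx i)
  have hu : √(7 : ℝ) * √7 = 7 := by simp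
  have hv : √(s : ℝ) * √s = s := by simp
  have e : ∀ i, 4 * x i ^ 2 =
      ((A i ^ 2 + 7 * B i ^ 2 + s * C i ^ 2 + 7 * s * D i ^ 2 : ℤ) : ℝ)
      + 2 * ((A i * B i + s * (C i * D i) : ℤ) : ℝ) * √7
      + (2 * ((A i * C i + 7 * (B i * D i) : ℤ) : ℝ)
      + 2 * ((A i * D i + B i * C i : ℤ) : ℝ) * √7) * √s := fun i => by
    have : 4 * x i ^ 2 = (2 * x i) ^ 2 := by ring
    rw [this, hABCD i]
    push_cast
    generalize √(7 : ℝ) = u at *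
    generalize √(s : ℝ) = v at *
    linear_combination ((B i : ℝ) ^ 2 + 2 * B i * D i * v + D i ^ 2 * v ^ 2) * hu +
      ((C i : ℝ) ^ 2 + 2 * C i * D i * u + 7 * D i ^ 2) * hv
  have e2 : 4 * ∑ i, x i ^ 2 =
      ((∑ i, (A i ^ 2 + 7 * B i ^ 2 + s * C i ^ 2 + 7 * s * D i ^ 2) : ℤ) : ℝ)
      + 2 * ((∑ i, (A i * B i + s * (C i * D i)) : ℤ) : ℝ) * √7
      + (2 * ((∑ i, (A i * C i + 7 * (B i * D i)) : ℤ) : ℝ)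
      + 2 * ((∑ i, (A i * D i + B i * C i) : ℤ) : ℝ) * √7) * √s := by
    rw [Finset.mul_sum, Finset.sum_congr rfl fun i _ => e i]
    rw [sum_split]
    simp only [Int.cast_sum]
  rw [← h] at e2
  refine core s hs13 A B C D hAC hBD ?_ ?_ ?_ ?_ <;>
  generalize (∑ i, (A i ^ 2 + 7 * B i ^ 2 + s * C i ^ 2 + 7 * s * D i ^ 2) : ℤ) = S1 at * <;>
  generalize (∑ i, (A i * B i + s * (C i * D i)) : ℤ) = S2 at * <;>
  generalize (∑ i, (A i * C i + 7 * (B i * D i)) : ℤ) = S3 at * <;>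
  generalize (∑ i, (A i * D i + B i * C i) : ℤ) = S4 at * <;>
  obtain ⟨r1, r2, r3, r4⟩ := indep s hsf hs7 h7 (S1 - (54 + 2 * s)) (2 * S2 - 8) (2 * S3 - 8)
    (2 * S4) (by push_cast; linear_combination 4 * hu + 2 * hv - e2)
  · have : (S1 : ℚ) = 54 + 2 * s := by linarith
    exact_mod_cast this
  · have : (S2 : ℚ) = 4 := by linarith
    exact_mod_cast this
  · have : (S3 : ℚ) = 4 := by linarith
    exact_mod_cast this
  · have : (S4 : ℚ) = 0 := by linarith
    exact_mod_cast this

lemma zero_mem_ring (s : ℕ) : (0 : ℝ) ∈ ringOfInt 7 (s : ℝ) :=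
  ⟨zero_mem _, isIntegral_zero⟩

lemma extend5 (S : Set ℝ) (h0 : (0 : ℝ) ∈ S) (n : ℕ) (hn : n ≤ 5) (α : ℝ)
    (h : SumOfSquaresLen S n α) : SumOfSquaresLen S 5 α := by
  induction hn using Nat.decreasingInduction with
  | self => exact h
  | of_succ k hk ih =>
    apply ih
    obtain ⟨x, hx, rfl⟩ := h
    refine ⟨Fin.snoc x 0, fun i => ?_, ?_⟩
    · refine Fin.lastCases ?_ (fun j => ?_) i
      · simpa using h0
      · simpa using hx j
    · simp [Fin.sum_univ_castSucc]

theorem m7_s1_length_six (s : ℕ) (hs4 : s % 4 = 1) (hsf : Squarefree s)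
    (hs7 : 7 < s) (h7 : ¬ (7 ∣ s)) :
    (¬ ∃ n : ℕ, n ≤ 5 ∧ SumOfSquaresLen (ringOfInt 7 (s : ℝ)) n
        ((1 : ℝ) ^ 2 + 1 ^ 2 + 1 ^ 2 + (1 + Real.sqrt 7) ^ 2
          + ((1 + Real.sqrt s) / 2) ^ 2 + (1 + (1 + Real.sqrt s) / 2) ^ 2)) ∧
    6 ≤ pythagorasNumber (ringOfInt 7 (s : ℝ)) := by
  have main : ¬ ∃ n : ℕ, n ≤ 5 ∧ SumOfSquaresLen (ringOfInt 7 (s : ℝ)) n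
        ((1 : ℝ) ^ 2 + 1 ^ 2 + 1 ^ 2 + (1 + Real.sqrt 7) ^ 2
          + ((1 + Real.sqrt s) / 2) ^ 2 + (1 + (1 + Real.sqrt s) / 2) ^ 2) := by
    rintro ⟨n, hn, h⟩
    obtain ⟨x, hx, h⟩ := extend5 _ (zero_mem_ring s) n hn _ h
    exact part1 s hs4 hsf hs7 h7 x hx h
  refine ⟨main, ?_⟩
  refine le_sSup_of_le ⟨((1 : ℝ) ^ 2 + 1 ^ 2 + 1 ^ 2 + (1 + Real.sqrt 7) ^ 2
          + ((1 + Real.sqrt s) / 2) ^ 2 + (1 + (1 + Real.sqrt s) / 2) ^ 2), ⟨6, ?_⟩, rfl⟩ (le_sInf (a := 6) ?_)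
  · have f7 : √(7 : ℝ) ∈ biquadField 7 s := IntermediateField.subset_adjoin _ _ (by simp)
    have fs : √(s : ℝ) ∈ biquadField 7 s := IntermediateField.subset_adjoin _ _ (by simp)
    have f2 : (2 : ℝ) ∈ biquadField 7 s := ofNat_mem _ 2
    have i7 : IsIntegral ℤ √(7 : ℝ) :=
      ⟨Polynomial.X ^ 2 - Polynomial.C 7, Polynomial.monic_X_pow_sub_C _ two_ne_zero, by simp⟩
    have is : IsIntegral ℤ ((1 + √(s : ℝ)) / 2) := by
      obtain ⟨t, ht⟩ : ∃ t : ℤ, (s : ℤ) = 4 * t + 1 := ⟨s / 4, by omega⟩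
      have ht' : (s : ℝ) = 4 * t + 1 := by exact_mod_cast ht
      have hv : √(s : ℝ) * √s = s := by simp
      refine ⟨Polynomial.X ^ 2 - (Polynomial.X + Polynomial.C t), ?_, ?_⟩
      · apply Polynomial.monic_X_pow_sub
        compute_degree
        all_goals norm_num
      · simp only [Polynomial.eval₂_sub, Polynomial.eval₂_add, Polynomial.eval₂_pow,
          Polynomial.eval₂_X, Polynomial.eval₂_C, algebraMap_int_eq]
        rw [eq_intCast]
        linear_combination hv / 4 + ht' / 4
    have m1 : (1 : ℝ) ∈ ringOfInt 7 (s : ℝ) := ⟨one_mem _, isIntegral_one⟩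
    have m2 : (1 + √7 : ℝ) ∈ ringOfInt 7 (s : ℝ) := ⟨add_mem (one_mem _) f7, isIntegral_one.add i7⟩
    have m3 : ((1 + √s) / 2 : ℝ) ∈ ringOfInt 7 (s : ℝ) :=
      ⟨div_mem (add_mem (one_mem _) fs) f2, is⟩
    have m4 : (1 + (1 + √s) / 2 : ℝ) ∈ ringOfInt 7 (s : ℝ) :=
      ⟨add_mem (one_mem _) m3.1, isIntegral_one.add m3.2⟩
    refine ⟨![1, 1, 1, 1 + √7, (1 + √s) / 2, 1 + (1 + √s) / 2], fun i => ?_, ?_⟩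
    · fin_cases i
      exacts [m1, m1, m1, m2, m3, m4]
    · simp [Fin.sum_univ_six]
  · rintro n ⟨k, rfl, hk⟩
    by_contra hlt
    refine main ⟨k, ?_, hk⟩
    by_contra hk5
    apply hlt
    exact_mod_cast (by omega : 6 ≤ k)
end
end

section
/- Let s ≡ 1 (mod 4) be square-free with s ≥ 13, 7 ∤ s, and K = Q(√7, √s). If α = 1² + 1² + 1² + (1+√7)² + ((1+√s)/2)² + (1+(1+√s)/2)² = Σ x_i² with all x_i ∈ O_K, then up to reordering the summands and replacing x_i by -x_i, the representation is unique: α = ((3+√s)/2)² + ((1+√s)/2)² + (1+√7)² + 1² + 1² + 1². -/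
open scoped Classical

noncomputable section

lemma int_of_sq (m : ℕ) (hm : Squarefree m) (q : ℚ) (N : ℤ) (h : (m:ℚ) * q^2 = N) : ∃ k : ℤ, q = k := by
  have hd : (q.den:ℚ) ≠ 0 := by exact_mod_cast q.den_nz
  have h1 : (m:ℤ) * q.num^2 = N * (q.den:ℤ)^2 := by
    have : (m:ℚ) * (q.num:ℚ)^2 = N * (q.den:ℚ)^2 := by
      rw [← h]; nth_rewrite 2 [← Rat.num_div_den q]; field_simp
    exact_mod_cast this
  have h2 : ((q.den:ℤ)^2) ∣ (m:ℤ) * q.num^2 := ⟨N, by rw [h1]; ring⟩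
  have hc : IsCoprime ((q.den:ℤ)^2) (q.num^2) := by
    apply IsCoprime.pow
    rw [Int.isCoprime_iff_nat_coprime]
    simpa using q.reduced.symm
  have h3 : ((q.den:ℤ)^2) ∣ (m:ℤ) := hc.dvd_of_dvd_mul_right h2
  have h4 : q.den * q.den ∣ m := by rw [← sq]; exact_mod_cast h3
  have h5 := Nat.isUnit_iff.1 (hm _ h4)
  exact ⟨q.num, (Rat.den_eq_one_iff q).1 h5 |>.symm⟩

lemma lin_indep (s : ℕ) (hs : ¬ IsSquare s) (h7s : ¬ IsSquare (7 * s)) (a b c d : ℚ)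
    (h : (a:ℝ) + b * √7 + c * √(s:ℝ) + d * (√7 * √(s:ℝ)) = 0) : a = 0 ∧ b = 0 ∧ c = 0 ∧ d = 0 := by
  have hu : Irrational (√7) := by
    have := (Nat.prime_seven).irrational_sqrt
    simpa using this
  have hv : Irrational (√(s:ℝ)) := irrational_sqrt_natCast_iff.2 hs
  have huv : Irrational (√7 * √(s:ℝ)) := by
    have := irrational_sqrt_natCast_iff.2 h7s
    push_cast at this
    rwa [Real.sqrt_mul (by norm_num)] at this
  have u2 : √7 ^ 2 = (7:ℝ) := Real.sq_sqrt (by norm_num)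
  have v2 : √(s:ℝ) ^ 2 = (s:ℝ) := Real.sq_sqrt (by positivity)
  set u := √7
  set v := √(s:ℝ)
  have two : ∀ (w : ℝ), Irrational w → ∀ p q : ℚ, (p:ℝ) + q * w = 0 → p = 0 ∧ q = 0 := by
    intro w hw p q hpq
    have hq : q = 0 := by
      by_contra hq
      apply hw
      refine ⟨-p / q, ?_⟩
      have : (q:ℝ) ≠ 0 := by exact_mod_cast hq
      push_cast
      field_simp
      linarith
    subst hq
    simp at hpq
    exact ⟨hpq, rfl⟩
  have key : c^2 - 7 * d^2 = 0 := by
    by_contra hk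
    set k := c^2 - 7 * d^2 with hkdef
    have hk' : (k:ℝ) ≠ 0 := by exact_mod_cast hk
    have e1 : v * k = ((7*b*d - a*c : ℚ):ℝ) + ((a*d-b*c : ℚ):ℝ) * u := by
      rw [hkdef]; push_cast
      linear_combination (c - d*u) * h + (b*d + d^2 * v) * u2
    set e := 7*b*d - a*c
    set f := a*d-b*c
    have e2 : ((e^2 + 7*f^2 - s * k^2 : ℚ):ℝ) + ((2*e*f:ℚ):ℝ) * u = 0 := by
      push_cast
      linear_combination -(v*k + e + f*u) * e1 + (k:ℝ)^2 * v2 - (f:ℝ)^2 * u2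
    obtain ⟨-, e3⟩ := two u hu _ _ e2
    have e4 : e = 0 ∨ f = 0 := by simpa using e3
    rcases e4 with e4 | e4
    · rw [e4] at e1
      have := two (u*v) huv (-7 * f) k (by push_cast; push_cast at e1; linear_combination u * e1 + f * u2)
      exact hk this.2
    · rw [e4] at e1
      have := two v hv (-e) k (by push_cast; push_cast at e1; linear_combination e1)
      exact hk this.2
  have hcd : c = 0 ∧ d = 0 := by
    have : ((c:ℝ) + d * u) * (c - d*u) = 0 := by
      have : ((c:ℝ)^2 - 7 * d^2) = 0 := by exact_mod_cast key
      linear_combination this - d^2 * u2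
    rcases mul_eq_zero.1 this with h | h
    · exact two u hu _ _ h
    · have := two u hu c (-d) (by push_cast; linear_combination h)
      exact ⟨this.1, by simpa using this.2⟩
  obtain ⟨rfl, rfl⟩ := hcd
  have := two u hu a b (by push_cast at h; linear_combination h)
  exact ⟨this.1, this.2, rfl, rfl⟩

lemma poly_form (m s : ℕ) (p q r t : ℚ) (P : Polynomial ℤ) : ∃ a b c d : ℚ, ∀ u v : ℝ,
    u^2 = m → v^2 = s → Polynomial.aeval ((p:ℝ) + q * u + r * v + t * (u*v)) P
      = (a:ℝ) + b * u + c * v + d * (u * v) := by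
  induction P using Polynomial.induction_on with
  | C k => exact ⟨k, 0, 0, 0, fun u v _ _ => by simp⟩
  | add P Q hP hQ =>
    obtain ⟨a, b, c, d, h⟩ := hP
    obtain ⟨a', b', c', d', h'⟩ := hQ
    refine ⟨a + a', b + b', c + c', d + d', fun u v hu hv => ?_⟩
    rw [map_add, h u v hu hv, h' u v hu hv]; push_cast; ring
  | monomial n k hP =>
    obtain ⟨a, b, c, d, h⟩ := hP
    refine ⟨a*p + m*b*q + s*c*r + m*s*d*t, a*q + b*p + s*c*t + s*d*r, a*r + c*p + m*b*t+m*d*q,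
      a*t+d*p+b*r+c*q, fun u v hu hv => ?_⟩
    have := h u v hu hv
    rw [pow_succ, ← mul_assoc (Polynomial.C k), map_mul _ (_ * _) Polynomial.X, this, Polynomial.aeval_X]; push_cast
    linear_combination (b*q + b * t * v + d*q*v+ d*t*v^2) * hu + (c*r+c*t*u+d*r*u+d*t*m)*hv

lemma conj_integral (s : ℕ) (hs : ¬ IsSquare s) (h7s : ¬ IsSquare (7 * s)) (p q r t : ℚ)
    (h : IsIntegral ℤ ((p:ℝ) + q * √7 + r * √(s:ℝ) + t * (√7 * √(s:ℝ)))) (u v : ℝ) (hu : u^2 = 7) (hv : v^2 = s) :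
    IsIntegral ℤ ((p:ℝ) + q * u + r * v + t * (u * v)) := by
  obtain ⟨P, hP, hx⟩ := h
  obtain ⟨a, b, c, d, hf⟩ := poly_form 7 s p q r t P
  have u2 : √7 ^ 2 = ((7:ℕ):ℝ) := by simp
  have v2 : √(s:ℝ) ^ 2 = (s:ℝ) := Real.sq_sqrt (by positivity)
  have h1 := hf _ _ u2 v2
  rw [Polynomial.aeval_def, hx] at h1
  obtain ⟨rfl, rfl, rfl, rfl⟩ := lin_indep s hs h7s a b c d h1.symm
  refine ⟨P, hP, ?_⟩
  rw [← Polynomial.aeval_def, hf u v (by simpa using hu) hv]; simp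

lemma integral_congr {a b : ℝ} (h : IsIntegral ℤ a) (e : b = a) : IsIntegral ℤ b := e ▸ h

lemma rat_int (q : ℚ) (h : IsIntegral ℤ (q:ℝ)) : ∃ k : ℤ, q = k := by
  have h' : IsIntegral ℤ q := by
    have hinj : Function.Injective (algebraMap ℚ ℝ) := (algebraMap ℚ ℝ).injective
    exact (isIntegral_algHom_iff (x := q) (Algebra.ofId ℚ ℝ |>.restrictScalars ℤ) hinj).1 h
  obtain ⟨k, hk⟩ := IsIntegrallyClosed.isIntegral_iff.1 h'
  exact ⟨k, by simpa using hk.symm⟩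

lemma sq4 (x : ℤ) : (x % 2 = 0 ∧ x^2 % 4 = 0) ∨ (x % 2 = 1 ∧ x^2 % 4 = 1) := by
  rcases Int.even_or_odd' x with ⟨k, rfl | rfl⟩
  · left; constructor; omega
    ring_nf; omega
  · right; constructor; omega
    ring_nf; omega

lemma coords_s5 (s : ℕ) (hs4 : s % 4 = 1) (hsf : Squarefree s) (h7 : ¬ (7 ∣ s)) (hs : ¬ IsSquare s) (h7s : ¬ IsSquare (7 * s)) (p q r t : ℚ)
    (h : IsIntegral ℤ ((p:ℝ) + q * √7 + r * √(s:ℝ) + t * (√7 * √(s:ℝ)))) :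
    ∃ A B C D : ℤ, 2 * p = A ∧ 2 * q = B ∧ 2 * r = C ∧ 2 * t = D ∧ A % 2 = C % 2 ∧ B % 2 = D % 2 := by
  have u2 : √7 ^ 2 = (7:ℝ) := Real.sq_sqrt (by norm_num)
  have v2 : √(s:ℝ) ^ 2 = (s:ℝ) := Real.sq_sqrt (by positivity)
  have H := conj_integral s hs h7s p q r t h
  set u := √7
  set v := √(s:ℝ)
  have y1 := H u v u2 v2
  have y2 := H u (-v) u2 (by simpa using v2)
  have y3 := H (-u) v (by simpa using u2) v2
  have y4 := H (-u) (-v) (by simpa using u2) (by simpa using v2)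
  have hsf7 : Squarefree (7 * s) := by
    rw [Nat.squarefree_mul_iff]
    exact ⟨(Nat.Prime.coprime_iff_not_dvd Nat.prime_seven).2 h7, Nat.prime_seven.squarefree, hsf⟩
  obtain ⟨T, hT⟩ := rat_int (4 * p) (by
    refine integral_congr (((y1.add y2).add y3).add y4) ?_; push_cast; ring)
  obtain ⟨N, hN⟩ := rat_int (4 * p^2 - 28 * q^2) (by
    refine integral_congr ((y1.add y2).mul (y3.add y4)) ?_; push_cast; linear_combination (4 * q^2 : ℝ) * u2)
  obtain ⟨Q, hQ⟩ := int_of_sq 7 Nat.prime_seven.squarefree (4 * q) (T^2 - 4 * N) (by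
    push_cast; rw [← hN, ← hT]; ring)
  have hTQ : T^2 - 7 * Q^2 = 4 * N := by
    have : (T:ℚ)^2 - 7 * Q^2 = 4 * N := by rw [← hN, ← hT, ← hQ]; ring
    exact_mod_cast this
  obtain ⟨A, hA⟩ : ∃ A, T = 2 * A := ⟨T / 2, by rcases sq4 T with h | h <;> rcases sq4 Q with h' | h' <;> omega⟩
  obtain ⟨B, hB⟩ : ∃ A, Q = 2 * A := ⟨Q / 2, by rcases sq4 T with h | h <;> rcases sq4 Q with h' | h' <;> omega⟩
  have hA' : 2 * p = A := by subst hA; push_cast at hT; linarith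
  have hB' : 2 * q = B := by subst hB; push_cast at hQ; linarith
  obtain ⟨M, hM⟩ := rat_int (4 * p^2 - 4 * s * r^2) (by
    refine integral_congr ((y1.add y3).mul (y2.add y4)) ?_; push_cast; linear_combination (4 * r^2 : ℝ) * v2)
  obtain ⟨C, hC⟩ := int_of_sq s hsf (2 * r) (A^2 - M) (by
    push_cast; rw [← hM, ← hA']; ring)
  obtain ⟨M', hM'⟩ := rat_int (4 * p^2 - 4 * (7 * s) * t^2) (by
    refine integral_congr ((y1.add y4).mul (y2.add y3)) ?_; push_cast
    linear_combination (4 * t^2*v^2 : ℝ) * u2 + (28 * t^2 : ℝ) * v2)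
  obtain ⟨D, hD⟩ := int_of_sq (7 * s) hsf7 (2 * t) (A^2 - M') (by
    push_cast; rw [← hM', ← hA']; ring)
  have n1 : (p + q * u + r * v + t * (u*v)) * (p + q * u + r * (-v) + t * (u*(-v)))
      = (p^2+7*q^2-s*r^2-7*s*t^2) + (2*p*q-2*s*r*t) * u := by
    linear_combination (q^2 - t^2 * v^2) * u2 - ((r^2:ℝ) + 7 * t^2 + 2 * r * t * u) * v2
  have n2 : (p + q * (-u) + r * v + t * ((-u)*v)) * (p + q * (-u) + r * (-v) + t * ((-u)*(-v)))
      = (p^2+7*q^2-s*r^2-7*s*t^2) - (2*p*q-2*s*r*t) * u := by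
    linear_combination (q^2 - t^2 * v^2) * u2 - ((r^2:ℝ) + 7 * t^2 - 2 * r * t * u) * v2
  have z1 := y1.mul y2
  have z2 := y3.mul y4
  rw [n1] at z1
  rw [n2] at z2
  obtain ⟨E, hE⟩ := rat_int (2 * (p^2+7*q^2-s*r^2-7*s*t^2)) (by
    refine integral_congr (z1.add z2) ?_; push_cast; ring)
  obtain ⟨G, hG⟩ := rat_int ((p^2+7*q^2-s*r^2-7*s*t^2)^2 - 7 * (2*p*q-2*s*r*t)^2) (by
    refine integral_congr (z1.mul z2) ?_; push_cast; linear_combination (2*p*q-2*s*r*t : ℝ)^2 * u2)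
  have g1 : 2 * E = A^2 + 7 * B^2 - s * C^2 - 7 * s * D^2 := by
    have : (2:ℚ) * E = A^2 + 7 * B^2 - s * C^2 - 7 * s * D^2 := by
      rw [← hE, ← hA', ← hB', ← hC, ← hD]; ring
    exact_mod_cast this
  have g2 : E^2 - 7 * (A * B - s * C * D)^2 = 4 * G := by
    have : (E:ℚ)^2 - 7 * (A * B - s * C * D)^2 = 4 * G := by
      rw [← hG, ← hE, ← hA', ← hB', ← hC, ← hD]; ring
    exact_mod_cast this
  refine ⟨A, B, C, D, hA', hB', hC, hD, ?_⟩
  obtain ⟨k, hk⟩ : ∃ k : ℤ, (s:ℤ) = 4 * k + 1 := ⟨s / 4, by omega⟩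
  rw [hk] at g1 g2
  have g3 : (A * B - (4*k+1) * C * D) % 2 = 0 ∧ E % 2 = 0 := by
    rcases sq4 E with h | h <;> rcases sq4 (A * B - (4*k+1) * C * D) with h' | h' <;> omega
  have g4 : (A * B - C * D) % 2 = 0 := by
    have : (A * B - (4*k+1) * C * D) = A * B - C * D - 2 * (2 * k * C * D) := by ring
    omega
  have g5 : (A^2 - B^2 - C^2 + D^2) % 4 = 0 := by
    have : 2 * E = (A^2 - B^2 - C^2 + D^2) + 4 * (2 * B^2 - k * C^2 - 7 * k * D^2 - 2 * D^2) := by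
      rw [g1]; ring
    omega
  have g6 := Int.sub_emod (A * B) (C * D) 2
  rw [Int.mul_emod A B, Int.mul_emod C D] at g6
  rcases sq4 A with ⟨a1, a2⟩ | ⟨a1, a2⟩ <;> rcases sq4 B with ⟨b1, b2⟩ | ⟨b1, b2⟩ <;>
  rcases sq4 C with ⟨c1, c2⟩ | ⟨c1, c2⟩ <;> rcases sq4 D with ⟨d1, d2⟩ | ⟨d1, d2⟩ <;>
  rw [a1, b1, c1, d1] at g6 <;> norm_num at g6 <;> omega

lemma field_form (s : ℕ) (x : ℝ) (hx : x ∈ biquadField 7 (s:ℝ)) :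
    ∃ p q r t : ℚ, x = (p:ℝ) + q * √7 + r * √(s:ℝ) + t * (√7 * √(s:ℝ)) := by
  have u2 : √7 ^ 2 = (7:ℝ) := Real.sq_sqrt (by norm_num)
  have v2 : √(s:ℝ) ^ 2 = (s:ℝ) := Real.sq_sqrt (by positivity)
  have halg : ∀ y ∈ ({√7, √(s:ℝ)} : Set ℝ), IsAlgebraic ℚ y := by
    intro y hy
    apply IsIntegral.isAlgebraic
    rcases hy with rfl | rfl
    · apply IsIntegral.of_pow (n := 2) (by norm_num)
      rw [u2]
      have h : IsIntegral ℚ ((7:ℚ):ℝ) := isIntegral_algebraMap (x := (7:ℚ))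
      norm_num at h
      exact h
    · apply IsIntegral.of_pow (n := 2) (by norm_num)
      rw [v2]; exact isIntegral_algebraMap (R := ℚ) (x := (s:ℚ)) |> fun h => by simpa using h
  have hx' : x ∈ Algebra.adjoin ℚ ({√7, √(s:ℝ)} : Set ℝ) := by
    rw [← IntermediateField.adjoin_toSubalgebra_of_isAlgebraic halg]
    exact hx
  induction hx' using Algebra.adjoin_induction with
  | mem y hy =>
    rcases hy with rfl | rfl
    · exact ⟨0, 1, 0, 0, by simp⟩
    · exact ⟨0, 0, 1, 0, by simp⟩
  | algebraMap k => exact ⟨k, 0, 0, 0, by simp⟩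
  | add y z hy hz h1 h2 =>
    have e : ∀ w, w ∈ Algebra.adjoin ℚ ({√7, √(s:ℝ)} : Set ℝ) → w ∈ biquadField 7 (s:ℝ) := by
      intro w hw
      rwa [← IntermediateField.adjoin_toSubalgebra_of_isAlgebraic halg] at hw
    obtain ⟨p, q, r, t, rfl⟩ := h1 (e _ hy)
    obtain ⟨p', q', r', t', rfl⟩ := h2 (e _ hz)
    exact ⟨p + p', q + q', r + r', t + t', by push_cast; ring⟩
  | mul y z hy hz h1 h2 =>
    have e : ∀ w, w ∈ Algebra.adjoin ℚ ({√7, √(s:ℝ)} : Set ℝ) → w ∈ biquadField 7 (s:ℝ) := by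
      intro w hw
      rwa [← IntermediateField.adjoin_toSubalgebra_of_isAlgebraic halg] at hw
    obtain ⟨a, b, c, d, rfl⟩ := h1 (e _ hy)
    obtain ⟨p, q, r, t, rfl⟩ := h2 (e _ hz)
    refine ⟨a*p + 7*b*q + s*c*r + 7*s*d*t, a*q + b*p + s*c*t + s*d*r, a*r + c*p + 7*b*t+7*d*q,
      a*t+d*p+b*r+c*q, ?_⟩
    set u := √7
    set v := √(s:ℝ)
    push_cast
    linear_combination (b*q + b * t * v + d*q*v+ d*t*v^2) * u2 + (c*r+c*t*u+d*r*u+d*t*7)*v2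

lemma sq_small {ι : Type*} (S : Finset ι) (f : ι → ℤ) (N : ℕ) (hN : N ≤ 3)
    (h : ∑ i ∈ S, f i ^ 2 = N) :
    (∀ i ∈ S, f i ≠ 0 → f i ^ 2 = 1) ∧ (S.filter fun i => f i ≠ 0).card = N := by
  have h1 : ∀ i ∈ S, f i ≠ 0 → f i ^ 2 = 1 := by
    intro i hi h0
    have h2 : f i ^ 2 ≤ N := h ▸ Finset.single_le_sum (f := fun i => f i ^ 2) (fun j _ => sq_nonneg _) hi
    have h3 : f i ^ 2 ≤ 3 := h2.trans (by exact_mod_cast hN)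
    have h4 : f i < 2 := by nlinarith
    have h5 : -2 < f i := by nlinarith
    have h6 : f i = 1 ∨ f i = -1 := by omega
    rcases h6 with h6 | h6 <;> rw [h6] <;> norm_num
  refine ⟨h1, ?_⟩
  have h2 : ∑ i ∈ S, f i ^ 2 = ∑ i ∈ S, if f i ≠ 0 then 1 else 0 := by
    apply Finset.sum_congr rfl
    intro i hi
    by_cases h0 : f i = 0
    · simp [h0]
    · simp [h0, h1 i hi h0]
  rw [h2, ← Finset.sum_filter, Finset.sum_const] at h
  simpa using h

/-- Integer combinatorial core. -/
lemma core_s5 (s : ℕ) (hs13 : 13 ≤ s) (n : ℕ) (A B C D : Fin n → ℤ)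
    (hAC : ∀ i, A i % 2 = C i % 2) (hBD : ∀ i, B i % 2 = D i % 2)
    (e1 : ∑ i, (A i ^ 2 + 7 * B i ^ 2 + s * C i ^ 2 + 7 * s * D i ^ 2) = 54 + 2 * (s:ℤ))
    (e2 : ∑ i, (A i * B i + s * C i * D i) = 4)
    (e3 : ∑ i, (A i * C i + 7 * B i * D i) = 4)
    (e4 : ∑ i, (A i * D i + B i * C i) = 0) :
    (∀ i, D i = 0) ∧ ∃ i j k : Fin n, i ≠ j ∧ i ≠ k ∧ j ≠ k ∧
      (C i = 0 ∧ A i * B i = 4 ∧ A i ^ 2 = 4 ∧ B i ^ 2 = 4) ∧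
      (B j = 0 ∧ A j * C j = 3 ∧ A j ^ 2 = 9 ∧ C j ^ 2 = 1) ∧
      (B k = 0 ∧ A k * C k = 1 ∧ A k ^ 2 = 1 ∧ C k ^ 2 = 1) ∧
      (∀ l, l ≠ i → l ≠ j → l ≠ k → B l = 0 ∧ C l = 0 ∧ (A l = 0 ∨ A l ^ 2 = 4)) ∧
      (((((Finset.univ.erase i).erase j).erase k).filter fun l => A l ≠ 0).card = 3) := by
  have hs : (13:ℤ) ≤ s := by exact_mod_cast hs13
  have zero_of : ∀ f : Fin n → ℤ, ∑ i, f i ^ 2 ≤ 0 → ∀ i, f i = 0 := by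
    intro f hf i
    have := Finset.single_le_sum (f := fun i => f i ^ 2) (fun j _ => sq_nonneg _) (Finset.mem_univ i)
    have h2 : f i ^ 2 ≤ 0 := this.trans hf
    nlinarith
  have nn : ∀ f : Fin n → ℤ, 0 ≤ ∑ i, f i ^ 2 := fun f => Finset.sum_nonneg fun i _ => sq_nonneg _
  have e1' : ∑ i, A i ^ 2 + 7 * ∑ i, B i ^ 2 + s * ∑ i, C i ^ 2 + 7 * s * ∑ i, D i ^ 2 = 54 + 2 * s := by
    rw [← e1]; simp only [Finset.sum_add_distrib, Finset.mul_sum]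
  have hD : ∀ i, D i = 0 := by
    apply zero_of
    by_contra hc
    push Not at hc
    have := nn A; have := nn B; have := nn C
    nlinarith [mul_nonneg (by linarith : (0:ℤ) ≤ s) (nn C),
      mul_nonneg (by linarith : (0:ℤ) ≤ s) (by linarith : 0 ≤ ∑ i, D i ^ 2 - 1)]
  refine ⟨hD, ?_⟩
  have hb : ∀ i, ∃ b, B i = 2 * b := fun i => ⟨B i / 2, by have := hBD i; rw [hD i] at this; omega⟩
  choose b hb using hb
  simp only [hD, mul_zero, add_zero, zero_add, hb] at e2 e3 e4
  have e1b : ∑ i, A i ^ 2 + 28 * ∑ i, b i ^ 2 + s * ∑ i, C i ^ 2 = 54 + 2 * s := by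
    rw [← e1']
    simp only [hD, hb, mul_pow, ← Finset.mul_sum]
    simp; ring
  have e2b : ∑ i, A i * b i = 2 := by
    have : 2 * ∑ i, A i * b i = 4 := by
      rw [← e2, Finset.mul_sum]; exact Finset.sum_congr rfl fun i _ => by ring
    linarith
  have e4b : ∑ i, b i * C i = 0 := by
    have : 2 * ∑ i, b i * C i = 0 := by
      rw [← e4, Finset.mul_sum]; exact Finset.sum_congr rfl fun i _ => by ring
    linarith
  have hSC : ∃ k, ∑ i, C i ^ 2 = 2 * k := by
    have hc : ∀ i, ∃ c, A i = C i + 2 * c := fun i => ⟨(A i - C i) / 2, by have := hAC i; omega⟩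
    choose c hc using hc
    have : ∑ i, A i * C i = ∑ i, C i ^ 2 + 2 * ∑ i, c i * C i := by
      rw [Finset.mul_sum, ← Finset.sum_add_distrib]
      exact Finset.sum_congr rfl fun i _ => by rw [hc i]; ring
    exact ⟨2 - ∑ i, c i * C i, by linarith⟩
  have hb1 : 1 ≤ ∑ i, b i ^ 2 := by
    by_contra hc
    have := zero_of b (by omega)
    simp [this] at e2b
  have hC1 : 1 ≤ ∑ i, C i ^ 2 := by
    by_contra hc
    have := zero_of C (by omega)
    simp [this] at e3
  have hA1 : 1 ≤ ∑ i, A i ^ 2 := by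
    by_contra hc
    have := zero_of A (by omega)
    simp [this] at e3
  have hC2 : ∑ i, C i ^ 2 = 2 := by
    obtain ⟨k, hk⟩ := hSC
    by_contra hc
    have : 4 ≤ ∑ i, C i ^ 2 := by omega
    nlinarith [mul_nonneg (by linarith : (0:ℤ) ≤ s) (by linarith : 0 ≤ ∑ i, C i ^ 2 - 4)]
  rw [hC2] at e1b
  have hb2 : ∑ i, b i ^ 2 = 1 := by omega
  have hA2 : ∑ i, A i ^ 2 = 26 := by omega
  obtain ⟨bs, bc⟩ := sq_small Finset.univ b 1 (by norm_num) (by simpa using hb2)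
  obtain ⟨Cs, Cc⟩ := sq_small Finset.univ C 2 (by norm_num) (by simpa using hC2)
  obtain ⟨i, hi⟩ := Finset.card_eq_one.1 bc
  obtain ⟨j, k, hjk, hj⟩ := Finset.card_eq_two.1 Cc
  have bi : ∀ l, b l ≠ 0 ↔ l = i := fun l => by
    have := congrArg (l ∈ ·) hi; simpa using this
  have Cj : ∀ l, C l ≠ 0 ↔ l = j ∨ l = k := fun l => by
    have := congrArg (l ∈ ·) hj; simpa using this
  have b0 : ∀ l, l ≠ i → b l = 0 := fun l hl => by
    by_contra h; exact hl ((bi l).1 h)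
  have C0 : ∀ l, l ≠ j → l ≠ k → C l = 0 := fun l hl hl' => by
    by_contra h; rcases (Cj l).1 h with h | h <;> contradiction
  have s2 : A i * b i = 2 := by
    rw [← e2b]; symm
    exact Finset.sum_eq_single i (fun l _ hl => by rw [b0 l hl, mul_zero]) (by simp)
  have s4 : b i * C i = 0 := by
    rw [← e4b]; symm
    exact Finset.sum_eq_single i (fun l _ hl => by rw [b0 l hl, zero_mul]) (by simp)
  have bisq := bs i (Finset.mem_univ _) ((bi i).2 rfl)
  have hCi : C i = 0 := by
    rcases mul_eq_zero.1 s4 with h | h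
    · exact absurd h ((bi i).2 rfl)
    · exact h
  have hij : i ≠ j := by
    rintro rfl; exact (Cj i).2 (Or.inl rfl) hCi
  have hik : i ≠ k := by
    rintro rfl; exact (Cj i).2 (Or.inr rfl) hCi
  have split : ∀ f : Fin n → ℤ, ∑ l, f l = f i + (f j + (f k +
      ∑ l ∈ ((Finset.univ.erase i).erase j).erase k, f l)) := by
    intro f
    rw [Finset.add_sum_erase _ _ (by simp [hjk.symm, hik.symm]), Finset.add_sum_erase _ _ (by simp [hij.symm]),
      Finset.add_sum_erase _ _ (by simp)]
  have mem : ∀ l, l ∈ ((Finset.univ.erase i).erase j).erase k → l ≠ i ∧ l ≠ j ∧ l ≠ k := by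
    intro l hl; simp at hl; tauto
  have Aisq : A i ^ 2 = 4 := by
    have : (A i * b i)^2 = 4 := by rw [s2]; norm_num
    rw [mul_pow, bisq] at this; linarith
  have s3 : A j * C j + A k * C k = 4 := by
    rw [split, hCi, Finset.sum_eq_zero] at e3
    · linarith
    · intro l hl; obtain ⟨-, h1, h2⟩ := mem l hl; rw [C0 l h1 h2, mul_zero]
  have Cjsq := Cs j (Finset.mem_univ _) ((Cj j).2 (Or.inl rfl))
  have Cksq := Cs k (Finset.mem_univ _) ((Cj k).2 (Or.inr rfl))
  rw [split, Aisq] at hA2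
  have hR0 : 0 ≤ ∑ l ∈ ((Finset.univ.erase i).erase j).erase k, A l ^ 2 := Finset.sum_nonneg fun i _ => sq_nonneg _
  have pj : (A j * C j)^2 = A j ^ 2 := by rw [mul_pow, Cjsq, mul_one]
  have pk : (A k * C k)^2 = A k ^ 2 := by rw [mul_pow, Cksq, mul_one]
  have oj : (A j * C j) % 2 = 1 := by
    have := hAC j
    rcases sq4 (C j) with h | h
    · omega
    · rw [Int.mul_emod, this, h.1]; rfl
  have hcase : (A j * C j = 3 ∧ A k * C k = 1) ∨ (A k * C k = 3 ∧ A j * C j = 1) := by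
    have hk' : A k * C k = 4 - A j * C j := by linarith
    rw [hk'] at pk ⊢
    set y := A j * C j
    have : y ^ 2 + (4 - y)^2 ≤ 22 := by linarith
    have y1 : y < 5 := by nlinarith
    have y2 : -1 < y := by nlinarith
    omega
  have hR : ∑ l ∈ ((Finset.univ.erase i).erase j).erase k, A l ^ 2 = 12 := by
    rcases hcase with ⟨h1, h2⟩ | ⟨h1, h2⟩
    · rw [h1] at pj; rw [h2] at pk; linarith
    · rw [h2] at pj; rw [h1] at pk; linarith
  have ha : ∀ l, ∃ a, (C l = 0 → A l = 2 * a) := fun l => ⟨A l / 2, fun h => by have := hAC l; rw [h] at this; omega⟩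
  choose a ha using ha
  have hR3 : ∑ l ∈ ((Finset.univ.erase i).erase j).erase k, a l ^ 2 = (3:ℕ) := by
    have : ∑ l ∈ ((Finset.univ.erase i).erase j).erase k, A l ^ 2
        = 4 * ∑ l ∈ ((Finset.univ.erase i).erase j).erase k, a l ^ 2 := by
      rw [Finset.mul_sum]
      refine Finset.sum_congr rfl fun l hl => ?_
      obtain ⟨-, h1, h2⟩ := mem l hl
      rw [ha l (C0 l h1 h2)]; ring
    push_cast; linarith
  obtain ⟨as, ac⟩ := sq_small _ a 3 le_rfl hR3
  have hcard : ((((Finset.univ.erase i).erase j).erase k).filter fun l => A l ≠ 0).card = 3 := by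
    rw [← ac]; congr 1
    apply Finset.filter_congr
    intro l hl
    obtain ⟨-, h1, h2⟩ := mem l hl
    rw [ha l (C0 l h1 h2)]; simp
  have hrest : ∀ l, l ≠ i → l ≠ j → l ≠ k → B l = 0 ∧ C l = 0 ∧ (A l = 0 ∨ A l ^ 2 = 4) := by
    intro l h1 h2 h3
    refine ⟨by rw [hb, b0 l h1, mul_zero], C0 l h2 h3, ?_⟩
    have hl := ha l (C0 l h2 h3)
    by_cases h0 : a l = 0
    · left; rw [hl, h0, mul_zero]
    · right
      have := as l (by simp [h1, h2, h3]) h0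
      rw [hl, mul_pow, this]; norm_num
  have hi' : C i = 0 ∧ A i * B i = 4 ∧ A i ^ 2 = 4 ∧ B i ^ 2 = 4 :=
    ⟨hCi, by rw [hb]; linarith, Aisq, by rw [hb, mul_pow, bisq]; norm_num⟩
  have Bj : B j = 0 := by rw [hb, b0 j hij.symm, mul_zero]
  have Bk : B k = 0 := by rw [hb, b0 k hik.symm, mul_zero]
  rcases hcase with ⟨h1, h2⟩ | ⟨h1, h2⟩
  · exact ⟨i, j, k, hij, hik, hjk, hi', ⟨Bj, h1, by rw [← pj, h1]; norm_num, Cjsq⟩,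
      ⟨Bk, h2, by rw [← pk, h2]; norm_num, Cksq⟩, hrest, hcard⟩
  · exact ⟨i, k, j, hik, hij, hjk.symm, hi', ⟨Bk, h1, by rw [← pk, h1]; norm_num, Cksq⟩,
      ⟨Bj, h2, by rw [← pj, h2]; norm_num, Cjsq⟩, fun l a b c => hrest l a c b, by
        rw [Finset.erase_right_comm (a := k) (b := j)]; exact hcard⟩

theorem m7_s1_unique_rep (s : ℕ) (hs4 : s % 4 = 1) (hsf : Squarefree s)
    (hs13 : 13 ≤ s) (h7 : ¬ (7 ∣ s))
    (n : ℕ) (x : Fin n → ℝ) (hx : ∀ i, x i ∈ ringOfInt 7 (s : ℝ))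
    (hrep : (1 : ℝ) ^ 2 + 1 ^ 2 + 1 ^ 2 + (1 + Real.sqrt 7) ^ 2
        + ((1 + Real.sqrt s) / 2) ^ 2 + (1 + (1 + Real.sqrt s) / 2) ^ 2
        = ∑ i, x i ^ 2) :
    ((Finset.univ.val.map fun i => x i ^ 2).filter fun r => r ≠ 0)
      = ({((3 + Real.sqrt s) / 2) ^ 2, ((1 + Real.sqrt s) / 2) ^ 2,
          (1 + Real.sqrt 7) ^ 2, 1, 1, 1} : Multiset ℝ) := by
  have hs : ¬ IsSquare s := by
    rintro ⟨k, hk⟩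
    have := Nat.isUnit_iff.1 (hsf k ⟨1, by rw [hk, mul_one]⟩)
    subst this; omega
  have h7s : ¬ IsSquare (7 * s) := by
    rintro ⟨k, hk⟩
    have h1 : (7 * s) % 4 = 3 := by omega
    rw [hk, Nat.mul_mod] at h1
    have : k % 4 < 4 := Nat.mod_lt _ (by norm_num)
    interval_cases k % 4 <;> omega
  have u2 : √7 ^ 2 = (7:ℝ) := Real.sq_sqrt (by norm_num)
  have v2 : √(s:ℝ) ^ 2 = (s:ℝ) := Real.sq_sqrt (by positivity)
  have hc : ∀ i, ∃ A B C D : ℤ, x i = (A + B * √7 + C * √(s:ℝ) + D * (√7 * √(s:ℝ))) / 2 ∧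
      A % 2 = C % 2 ∧ B % 2 = D % 2 := by
    intro i
    obtain ⟨hK, hI⟩ := hx i
    obtain ⟨p, q, r, t, hp⟩ := field_form s (x i) hK
    rw [hp] at hI
    obtain ⟨A, B, C, D, hA, hB, hC, hD, h1, h2⟩ := coords_s5 s hs4 hsf h7 hs h7s p q r t hI
    refine ⟨A, B, C, D, ?_, h1, h2⟩
    have hA : (2:ℝ) * p = A := by exact_mod_cast hA
    have hB : (2:ℝ) * q = B := by exact_mod_cast hB
    have hC : (2:ℝ) * r = C := by exact_mod_cast hC
    have hD : (2:ℝ) * t = D := by exact_mod_cast hD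
    rw [hp, ← hA, ← hB, ← hC, ← hD]; ring
  choose A B C D hx' hAC hBD using hc
  have hind := lin_indep s hs h7s
  set u := √7
  set v := √(s:ℝ)
  have hsq : ∀ i, 4 * x i ^ 2 = ((A i ^ 2 + 7 * B i ^ 2 + s * C i ^ 2 + 7 * s * D i ^ 2 : ℤ) : ℝ)
      + (2 * (A i * B i + s * C i * D i) : ℤ) * u + (2 * (A i * C i + 7 * B i * D i) : ℤ) * v
      + (2 * (A i * D i + B i * C i) : ℤ) * (u * v) := by
    intro i
    rw [hx' i]; push_cast
    linear_combination ((B i:ℝ)^2 + D i ^ 2 * v^2 + 2 * B i * D i * v) * u2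
      + ((C i:ℝ)^2 + 2 * C i * D i * u + 7 * D i ^ 2) * v2
  have hsum : 4 * ∑ i, x i ^ 2
      = ((∑ i, (A i ^ 2 + 7 * B i ^ 2 + s * C i ^ 2 + 7 * s * D i ^ 2) : ℤ) : ℝ)
      + ((2 * ∑ i, (A i * B i + s * C i * D i) : ℤ) : ℝ) * u
      + ((2 * ∑ i, (A i * C i + 7 * B i * D i) : ℤ) : ℝ) * v
      + ((2 * ∑ i, (A i * D i + B i * C i) : ℤ) : ℝ) * (u * v) := by
    rw [Finset.mul_sum, Finset.sum_congr rfl fun i _ => hsq i]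
    rw [Finset.sum_add_distrib, Finset.sum_add_distrib, Finset.sum_add_distrib,
      ← Finset.sum_mul, ← Finset.sum_mul, ← Finset.sum_mul,
      Finset.mul_sum, Finset.mul_sum, Finset.mul_sum,
      Int.cast_sum, Int.cast_sum, Int.cast_sum, Int.cast_sum]
  rw [← hrep] at hsum
  set E1 := ∑ i, (A i ^ 2 + 7 * B i ^ 2 + s * C i ^ 2 + 7 * s * D i ^ 2) with hE1
  set E2 := ∑ i, (A i * B i + s * C i * D i) with hE2
  set E3 := ∑ i, (A i * C i + 7 * B i * D i) with hE3
  set E4 := ∑ i, (A i * D i + B i * C i) with hE4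
  obtain ⟨z1, z2, z3, z4⟩ := hind (E1 - (54 + 2 * s)) (2 * E2 - 8) (2 * E3 - 8) (2 * E4) (by
    push_cast; push_cast at hsum
    linear_combination 4 * u2 + 2 * v2 - hsum)
  have w1 : E1 = 54 + 2 * s := by
    have : (E1:ℚ) = 54 + 2 * s := by linarith
    exact_mod_cast this
  have w2 : E2 = 4 := by
    have : (E2:ℚ) = 4 := by linarith
    exact_mod_cast this
  have w3 : E3 = 4 := by
    have : (E3:ℚ) = 4 := by linarith
    exact_mod_cast this
  have w4 : E4 = 0 := by
    have : (E4:ℚ) = 0 := by linarith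
    exact_mod_cast this
  obtain ⟨hD, i, j, k, hij, hik, hjk, ⟨ci, ab, ai, bi⟩, ⟨bj, acj, aj, cj⟩, ⟨bk, ack, ak, ck⟩, hrest, hcard⟩ :=
    core_s5 s hs13 n A B C D hAC hBD w1 w2 w3 w4
  have xi : x i ^ 2 = (1 + u) ^ 2 := by
    have h := hsq i
    rw [hD i, ci] at h
    have h1 : (A i:ℝ) * B i = 4 := by exact_mod_cast ab
    have h2 : (A i:ℝ)^2 = 4 := by exact_mod_cast ai
    have h3 : (B i:ℝ)^2 = 4 := by exact_mod_cast bi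
    push_cast at h
    linear_combination h / 4 + (1/2) * u * h1 + (1/4) * h2 + (7/4) * h3 - u2
  have xj : x j ^ 2 = ((3 + v) / 2) ^ 2 := by
    have h := hsq j
    rw [hD j, bj] at h
    have h1 : (A j:ℝ) * C j = 3 := by exact_mod_cast acj
    have h2 : (A j:ℝ)^2 = 9 := by exact_mod_cast aj
    have h3 : (C j:ℝ)^2 = 1 := by exact_mod_cast cj
    push_cast at h
    linear_combination h / 4 + (1/2) * v * h1 + (1/4) * h2 + (s/4) * h3 - v2 / 4
  have xk : x k ^ 2 = ((1 + v) / 2) ^ 2 := by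
    have h := hsq k
    rw [hD k, bk] at h
    have h1 : (A k:ℝ) * C k = 1 := by exact_mod_cast ack
    have h2 : (A k:ℝ)^2 = 1 := by exact_mod_cast ak
    have h3 : (C k:ℝ)^2 = 1 := by exact_mod_cast ck
    push_cast at h
    linear_combination h / 4 + (1/2) * v * h1 + (1/4) * h2 + (s/4) * h3 - v2 / 4
  have u0 : 0 ≤ u := Real.sqrt_nonneg _
  have v0 : 0 ≤ v := Real.sqrt_nonneg _
  set R := ((Finset.univ.erase i).erase j).erase k with hR
  have hxl : ∀ l ∈ R, (A l = 0 ∧ x l ^ 2 = 0) ∨ (A l ≠ 0 ∧ x l ^ 2 = 1) := by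
    intro l hl
    have hl' : l ≠ k ∧ l ≠ j ∧ l ≠ i := by simpa [hR] using hl
    obtain ⟨b0, c0, h0⟩ := hrest l hl'.2.2 hl'.2.1 hl'.1
    have h := hsq l
    rw [hD l, b0, c0] at h
    push_cast at h
    rcases h0 with h0 | h0
    · left; refine ⟨h0, ?_⟩
      rw [h0] at h; push_cast at h; linarith
    · right; refine ⟨by rintro h1; rw [h1] at h0; norm_num at h0, ?_⟩
      have h2 : (A l:ℝ)^2 = 4 := by exact_mod_cast h0
      rw [h2] at h; linarith
  have huniv : (Finset.univ : Finset (Fin n)).val = i ::ₘ j ::ₘ k ::ₘ R.val := by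
    rw [hR, Finset.erase_val, Multiset.cons_erase (by
        simp [hjk.symm, hik.symm, ← Finset.erase_val]),
      Finset.erase_val, Multiset.cons_erase (by simp [hij.symm, ← Finset.erase_val]),
      Finset.erase_val, Multiset.cons_erase (by simp)]
  have hRm : (R.val.map fun i => x i ^ 2).filter (fun r => r ≠ 0) = Multiset.replicate 3 1 := by
    rw [Multiset.eq_replicate]
    constructor
    · rw [Multiset.filter_map, Multiset.card_map, ← hcard]
      change _ = Multiset.card (Multiset.filter _ R.val)
      congr 1
      apply Multiset.filter_congr
      intro l hl
      rcases hxl l hl with ⟨h1, h2⟩ | ⟨h1, h2⟩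
      · simp [h1, h2]
      · simp [h1, h2]
    · intro y hy
      rw [Multiset.mem_filter, Multiset.mem_map] at hy
      obtain ⟨⟨l, hl, rfl⟩, hy⟩ := hy
      rcases hxl l hl with ⟨h1, h2⟩ | ⟨h1, h2⟩
      · exact absurd h2 hy
      · exact h2
  rw [huniv, Multiset.map_cons, Multiset.map_cons, Multiset.map_cons,
    Multiset.filter_cons_of_pos _ (by rw [xi]; positivity),
    Multiset.filter_cons_of_pos _ (by rw [xj]; positivity),
    Multiset.filter_cons_of_pos _ (by rw [xk]; positivity), hRm, xi, xj, xk]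
  rw [Multiset.cons_swap ((1 + u) ^ 2), Multiset.cons_swap ((1 + u) ^ 2)]
  rfl
end
end

section
/- Let s ≡ 2 (mod 4) be square-free with s ≥ 10 and gcd(s,7) = 1. Suppose integers a_i, b_i, c_i, d_i (finitely many nonzero) satisfy a_i ≡ b_i ≡ 0 (mod 2) and c_i ≡ d_i (mod 2), together with Σ a_i² + 7 Σ b_i² + s Σ c_i² + 7s Σ d_i² = 48 + 16s, Σ a_i b_i + s Σ c_i d_i = 4 + 2s, Σ a_i c_i + 7 Σ b_i d_i = 2, and Σ a_i d_i + Σ b_i c_i = 2. Then Σ d_i² = 2. -/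
open scoped Classical

theorem m7_s2_d_count (s : ℤ) (hs4 : s % 4 = 2) (hsf : Squarefree s)
    (hs10 : 10 ≤ s) (h7 : IsCoprime s 7)
    (a b c d : ℕ → ℤ)
    (hfa : (Function.support a).Finite) (hfb : (Function.support b).Finite)
    (hfc : (Function.support c).Finite) (hfd : (Function.support d).Finite)
    (haeven : ∀ i, 2 ∣ a i) (hbeven : ∀ i, 2 ∣ b i)
    (hpar : ∀ i, c i % 2 = d i % 2)
    (e1 : ∑ᶠ i, (a i) ^ 2 + 7 * ∑ᶠ i, (b i) ^ 2 + s * ∑ᶠ i, (c i) ^ 2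
        + 7 * s * ∑ᶠ i, (d i) ^ 2 = 48 + 16 * s)
    (e2 : ∑ᶠ i, a i * b i + s * ∑ᶠ i, c i * d i = 4 + 2 * s)
    (e3 : ∑ᶠ i, a i * c i + 7 * ∑ᶠ i, b i * d i = 2)
    (e4 : ∑ᶠ i, a i * d i + ∑ᶠ i, b i * c i = 2) :
    ∑ᶠ i, (d i) ^ 2 = 2 := by
  obtain ⟨S, hS⟩ : ∃ S : Finset ℕ, ∀ i, i ∉ S → a i = 0 ∧ b i = 0 ∧ c i = 0 ∧ d i = 0 := by
    refine ⟨hfa.toFinset ∪ hfb.toFinset ∪ hfc.toFinset ∪ hfd.toFinset, ?_⟩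
    intro i hi
    simpa [not_or, and_assoc] using hi
  have key : ∀ f : ℕ → ℤ, (∀ i, i ∉ S → f i = 0) → ∑ᶠ i, f i = ∑ i ∈ S, f i := by
    intro f hf
    apply finsum_eq_sum_of_support_subset
    intro i hi
    by_contra h
    exact hi (hf i (by simpa using h))
  rw [key _ (fun i hi => by simp [hS i hi]), key _ (fun i hi => by simp [hS i hi]),
    key _ (fun i hi => by simp [hS i hi]), key _ (fun i hi => by simp [hS i hi])] at e1
  rw [key _ (fun i hi => by simp [hS i hi]), key _ (fun i hi => by simp [hS i hi])] at e2 e3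
  rw [key (fun i => (d i) ^ 2) (fun i hi => by simp [hS i hi])]
  have hA : 0 ≤ ∑ i ∈ S, (a i) ^ 2 := Finset.sum_nonneg fun i _ => sq_nonneg _
  have hB : 0 ≤ ∑ i ∈ S, (b i) ^ 2 := Finset.sum_nonneg fun i _ => sq_nonneg _
  have hC : 0 ≤ ∑ i ∈ S, (c i) ^ 2 := Finset.sum_nonneg fun i _ => sq_nonneg _
  have hD : 0 ≤ ∑ i ∈ S, (d i) ^ 2 := Finset.sum_nonneg fun i _ => sq_nonneg _
  have hP : (4 : ℤ) ∣ ∑ i ∈ S, a i * b i :=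
    Finset.dvd_sum fun i _ => by simpa using mul_dvd_mul (haeven i) (hbeven i)
  have hQD : (2 : ℤ) ∣ ∑ i ∈ S, c i * d i - ∑ i ∈ S, (d i) ^ 2 := by
    rw [← Finset.sum_sub_distrib]
    refine Finset.dvd_sum fun i _ => ?_
    have h : (2 : ℤ) ∣ c i - d i := by have := hpar i; omega
    have e : c i * d i - d i ^ 2 = (c i - d i) * d i := by ring
    rw [e]
    exact h.mul_right _
  have hzero : ∑ i ∈ S, (d i) ^ 2 ≠ 0 := by
    intro h0
    have hd : ∀ i ∈ S, d i = 0 := by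
      intro i hi
      have := (Finset.sum_eq_zero_iff_of_nonneg (fun i _ => sq_nonneg (d i))).1 h0 i hi
      simpa using this
    have h1 : (4 : ℤ) ∣ ∑ i ∈ S, a i * c i := Finset.dvd_sum fun i hi => by
      have hc : (2 : ℤ) ∣ c i := by
        have := hpar i
        rw [hd i hi] at this
        omega
      simpa using mul_dvd_mul (haeven i) hc
    have h2 : ∑ i ∈ S, b i * d i = 0 := Finset.sum_eq_zero fun i hi => by simp [hd i hi]
    omega
  have hle : ∑ i ∈ S, (d i) ^ 2 ≤ 2 := by
    by_contra hcon
    have h3 : 3 ≤ ∑ i ∈ S, (d i) ^ 2 := by omega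
    have hsC : 0 ≤ s * ∑ i ∈ S, (c i) ^ 2 := mul_nonneg (by omega) hC
    have hsD : s * 3 ≤ s * ∑ i ∈ S, (d i) ^ 2 := mul_le_mul_of_nonneg_left h3 (by omega)
    linarith
  have hQ : (2 : ℤ) ∣ ∑ i ∈ S, c i * d i := by
    obtain ⟨k, hk⟩ : ∃ k, s = 4 * k + 2 := ⟨s / 4, by omega⟩
    generalize ∑ i ∈ S, c i * d i = Q at *
    have e : s * Q = 4 * (k * Q) + 2 * Q := by rw [hk]; ring
    omega
  omega
end

section
/- Let s ≡ 3 (mod 4) be square-free with s ≥ 15 and 7 ∤ s, and K = Q(√7, √s). Then α = 1² + 1² + 1² + (1+√7)² + ((√7+√s)/2)² + (1+(√7+√s)/2)² cannot be written as a sum of fewer than 6 squares of elements of O_K, and its only representation as a sum of squares (up to order and sign) is ((1+(√7+√s)/2))² + ((√7+√s)/2)² + (1+√7)² + 1² + 1² + 1². -/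
open scoped Classical

noncomputable section

lemma aux_congr {x y : ℝ} (h : IsIntegral ℤ x) (e : y = x) : IsIntegral ℤ y := e ▸ h

lemma aux_rat_int (d : ℕ) (hd : Squarefree d) (q : ℚ) (k : ℤ) (h : (d : ℚ) * q ^ 2 = k) :
    ∃ m : ℤ, q = m := by
  have hden : (q.den : ℚ) ≠ 0 := by exact_mod_cast q.den_nz
  have hq : q = q.num / q.den := (Rat.num_div_den q).symm
  have h1 : (d : ℚ) * (q.num : ℚ) ^ 2 = k * (q.den : ℚ) ^ 2 := by
    rw [← h]
    nth_rewrite 2 [hq]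
    field_simp
  have h2 : (d : ℤ) * q.num ^ 2 = k * (q.den : ℤ) ^ 2 := by exact_mod_cast h1
  have hco : IsCoprime ((q.den : ℤ) ^ 2) (q.num ^ 2) := by
    apply IsCoprime.pow
    rw [Int.isCoprime_iff_gcd_eq_one]
    have := q.reduced
    rw [Int.gcd_comm]
    simpa [Int.gcd, Nat.Coprime] using this
  have h3 : ((q.den : ℤ) ^ 2) ∣ (d : ℤ) := by
    apply hco.dvd_of_dvd_mul_right
    rw [h2]
    exact Dvd.intro_left k rfl
  have h4 : q.den * q.den ∣ d := by
    rw [← sq]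
    exact_mod_cast h3
  have h5 : q.den = 1 := by simpa using hd _ h4
  exact ⟨q.num, by rw [hq, h5]; simp⟩

lemma aux_no_sqrt (d : ℕ) (hd : Squarefree d) (h1 : 1 < d) (q : ℚ) : q ^ 2 ≠ d := by
  intro h
  obtain ⟨m, rfl⟩ := aux_rat_int 1 squarefree_one q d (by push_cast; linarith)
  have h2 : m ^ 2 = (d : ℤ) := by exact_mod_cast h
  have h3 : m.natAbs * m.natAbs = d := by
    zify
    rw [← h2]
    simp [sq]
  have h4 : IsUnit m.natAbs := hd _ (by rw [h3])
  have h5 : m.natAbs = 1 := by simpa using h4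
  rw [h5] at h3
  omega

lemma aux_sqfree (s : ℕ) (hsf : Squarefree s) (h7 : ¬ (7 ∣ s)) : Squarefree (7 * s) := by
  have h7p : Nat.Prime 7 := by norm_num
  rw [Nat.squarefree_mul ((Nat.Prime.coprime_iff_not_dvd h7p).2 h7)]
  exact ⟨h7p.prime.squarefree, hsf⟩

lemma aux_indep2 (d : ℕ) (hd : Squarefree d) (h1 : 1 < d) (r : ℝ) (hr : r ^ 2 = d) (a b : ℚ)
    (h : (a : ℝ) + b * r = 0) : a = 0 ∧ b = 0 := by
  by_cases hb : b = 0
  · subst hb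
    simpa using h
  · exfalso
    have hb' : (b : ℝ) ≠ 0 := by exact_mod_cast hb
    have h2 : r = ((-a / b : ℚ) : ℝ) := by
      push_cast
      field_simp
      linarith
    rw [h2] at hr
    exact aux_no_sqrt d hd h1 (-a / b) (by exact_mod_cast hr)

lemma aux_indep (s : ℕ) (hsf : Squarefree s) (hs15 : 15 ≤ s) (h7 : ¬ (7 ∣ s)) (r t : ℝ)
    (hr : r ^ 2 = 7) (ht : t ^ 2 = s) (a b c d : ℚ)
    (h : (a : ℝ) + b * r + c * t + d * (r * t) = 0) : a = 0 ∧ b = 0 ∧ c = 0 ∧ d = 0 := by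
  have h7p : Nat.Prime 7 := by norm_num
  have h7s : Squarefree 7 := h7p.prime.squarefree
  have i7 := aux_indep2 7 h7s (by norm_num) r (by exact_mod_cast hr)
  by_cases hz : c = 0 ∧ d = 0
  · obtain ⟨rfl, rfl⟩ := hz
    obtain ⟨h1, h2⟩ := i7 a b (by simpa using h)
    exact ⟨h1, h2, rfl, rfl⟩
  · exfalso
    -- norm of `c + d r`
    have hN : c ^ 2 - 7 * d ^ 2 ≠ 0 := by
      intro hN
      by_cases hd : d = 0
      · subst hd
        apply hz
        simpa using hN
      · apply aux_no_sqrt 7 h7s (by norm_num) (c / d)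
        field_simp
        push_cast
        linarith
    have hN' : ((c : ℝ) ^ 2 - 7 * d ^ 2) ≠ 0 := by exact_mod_cast hN
    -- t = e + f r
    obtain ⟨e, f, hef⟩ : ∃ e f : ℚ, t = e + f * r := by
      refine ⟨-(a * c - 7 * b * d) / (c ^ 2 - 7 * d ^ 2),
        -(b * c - a * d) / (c ^ 2 - 7 * d ^ 2), ?_⟩
      push_cast
      field_simp
      linear_combination (c - d * r) * h + (b * d + d ^ 2 * t) * hr
    have h2 : ((e ^ 2 + 7 * f ^ 2 - s : ℚ) : ℝ) + ((2 * e * f : ℚ) : ℝ) * r = 0 := by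
      push_cast
      rw [← ht, hef]
      linear_combination (- (f:ℝ) ^ 2) * hr
    obtain ⟨h3, h4⟩ := i7 _ _ h2
    have h5 : e = 0 ∨ f = 0 := by simpa using h4
    rcases h5 with rfl | rfl
    · apply aux_no_sqrt (7 * s) (aux_sqfree s hsf h7) (by omega) (7 * f)
      push_cast
      linarith
    · apply aux_no_sqrt s hsf (by omega) e
      linarith

lemma aux_poly (s : ℕ) (u v w z : ℚ) (p : Polynomial ℤ) :
    ∃ a b c d : ℚ, ∀ r t : ℝ, r ^ 2 = 7 → t ^ 2 = s →
      Polynomial.aeval ((u : ℝ) + v * r + w * t + z * (r * t)) p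
        = (a : ℝ) + b * r + c * t + d * (r * t) := by
  induction p using Polynomial.induction_on with
  | C k =>
    refine ⟨k, 0, 0, 0, fun r t hr ht => ?_⟩
    simp
  | add p q hp hq =>
    obtain ⟨a, b, c, d, h⟩ := hp
    obtain ⟨a', b', c', d', h'⟩ := hq
    refine ⟨a + a', b + b', c + c', d + d', fun r t hr ht => ?_⟩
    rw [map_add, h r t hr ht, h' r t hr ht]
    push_cast
    ring
  | monomial n k hp =>
    obtain ⟨a, b, c, d, h⟩ := hp
    refine ⟨a * u + 7 * b * v + s * c * w + 7 * s * d * z,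
      a * v + b * u + s * c * z + s * d * w,
      a * w + c * u + 7 * b * z + 7 * d * v,
      a * z + d * u + b * w + c * v, fun r t hr ht => ?_⟩
    have := h r t hr ht
    rw [show Polynomial.C k * Polynomial.X ^ (n + 1)
        = (Polynomial.C k * Polynomial.X ^ n) * Polynomial.X by rw [pow_succ, ← mul_assoc],
      map_mul _ (Polynomial.C k * Polynomial.X ^ n), this, Polynomial.aeval_X]
    push_cast
    linear_combination ((b:ℝ) * v + b * z * t + d * v * t + d * z * t ^ 2) * hr
      + ((c:ℝ) * w + c * z * r + d * w * r + 7 * d * z) * ht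

lemma aux_conj (s : ℕ) (hsf : Squarefree s) (hs15 : 15 ≤ s) (h7 : ¬ (7 ∣ s)) (r t : ℝ)
    (hr : r ^ 2 = 7) (ht : t ^ 2 = s) (u v w z : ℚ)
    (h : IsIntegral ℤ ((u : ℝ) + v * r + w * t + z * (r * t))) (r' t' : ℝ)
    (hr' : r' ^ 2 = 7) (ht' : t' ^ 2 = s) :
    IsIntegral ℤ ((u : ℝ) + v * r' + w * t' + z * (r' * t')) := by
  obtain ⟨p, hp, hpe⟩ := h
  obtain ⟨a, b, c, d, hh⟩ := aux_poly s u v w z p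
  have h1 := hh r t hr ht
  rw [Polynomial.aeval_def, hpe] at h1
  obtain ⟨rfl, rfl, rfl, rfl⟩ := aux_indep s hsf hs15 h7 r t hr ht a b c d h1.symm
  refine ⟨p, hp, ?_⟩
  have h2 := hh r' t' hr' ht'
  rw [Polynomial.aeval_def] at h2
  rw [h2]
  simp

lemma aux_int_rat (q : ℚ) (h : IsIntegral ℤ (q : ℝ)) : ∃ m : ℤ, q = m := by
  have h1 : IsIntegral ℤ q := by
    have : IsIntegral ℤ (algebraMap ℚ ℝ q) := by simpa using h
    exact (isIntegral_algebraMap_iff (algebraMap ℚ ℝ).injective).1 this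
  obtain ⟨m, hm⟩ := IsIntegrallyClosed.isIntegral_iff.1 h1
  exact ⟨m, by simpa using hm.symm⟩

/-- Integers of `ℚ(√d)` for `d ≡ 3 (mod 4)`. -/
lemma aux_quad (d : ℕ) (hd : Squarefree d) (hd4 : d % 4 = 3) (r : ℝ) (hr : r ^ 2 = d) (a b : ℚ)
    (h : IsIntegral ℤ ((a : ℝ) + b * r)) (h' : IsIntegral ℤ ((a : ℝ) - b * r)) :
    (∃ m : ℤ, a = m) ∧ ∃ m : ℤ, b = m := by
  obtain ⟨m, hm⟩ := aux_int_rat (2 * a) (by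
    have := h.add h'
    refine aux_congr this ?_
    push_cast
    ring)
  obtain ⟨n, hn⟩ := aux_int_rat (a ^ 2 - d * b ^ 2) (by
    have := h.mul h'
    refine aux_congr this ?_
    push_cast
    linear_combination (b : ℝ) ^ 2 * hr)
  obtain ⟨k, hk⟩ := aux_rat_int d hd (2 * b) (m ^ 2 - 4 * n) (by
    push_cast
    rw [← hm, ← hn]
    ring)
  have e : m ^ 2 - d * k ^ 2 = 4 * n := by
    have : (m : ℚ) ^ 2 - d * k ^ 2 = 4 * n := by
      rw [← hm, ← hn, ← hk]; ring
    exact_mod_cast this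
  obtain ⟨d', hd'⟩ : ∃ d' : ℤ, (d : ℤ) = 4 * d' + 3 := ⟨d / 4, by omega⟩
  rw [hd'] at e
  have e2 : m ^ 2 + k ^ 2 = 4 * (n + d' * k ^ 2 + k ^ 2) := by linear_combination e
  have key : m % 2 = 0 ∧ k % 2 = 0 := by
    generalize n + d' * k ^ 2 + k ^ 2 = y at e2
    rcases Int.even_or_odd' m with ⟨m', rfl | rfl⟩ <;> rcases Int.even_or_odd' k with ⟨k', rfl | rfl⟩ <;>
      ring_nf at e2 <;> constructor <;> omega
  obtain ⟨⟨m', hm'⟩, ⟨k', hk'⟩⟩ := And.intro (Int.dvd_of_emod_eq_zero key.1)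
    (Int.dvd_of_emod_eq_zero key.2)
  subst hm' hk'
  push_cast at hm hk
  exact ⟨⟨m', by linarith⟩, ⟨k', by linarith⟩⟩

lemma aux_form (s : ℕ) (x : ℝ) (hx : x ∈ biquadField 7 (s : ℝ)) :
    ∃ u v w z : ℚ, x = (u : ℝ) + v * Real.sqrt 7 + w * Real.sqrt s
      + z * (Real.sqrt 7 * Real.sqrt s) := by
  have h7 : Real.sqrt 7 ^ 2 = 7 := Real.sq_sqrt (by norm_num)
  have hs : Real.sqrt s ^ 2 = s := Real.sq_sqrt (by positivity)
  have i7 : IsIntegral ℚ (Real.sqrt 7) := by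
    apply IsIntegral.of_pow (n := 2) (by norm_num)
    rw [h7]; exact_mod_cast isIntegral_algebraMap (R := ℚ) (A := ℝ) (x := ((7 : ℕ) : ℚ))
  have is : IsIntegral ℚ (Real.sqrt s) := by
    apply IsIntegral.of_pow (n := 2) (by norm_num)
    rw [hs]; exact isIntegral_algebraMap (R := ℚ) (x := s) |> fun h => by simpa using h
  have hx' : x ∈ Algebra.adjoin ℚ {Real.sqrt 7, Real.sqrt s} := by
    rw [← IntermediateField.adjoin_toSubalgebra_of_isAlgebraic]
    · exact hx
    · rintro y (rfl | rfl)
      · exact i7.isAlgebraic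
      · exact is.isAlgebraic
  clear hx
  induction hx' using Algebra.adjoin_induction with
  | mem x hx =>
    rcases hx with rfl | rfl
    · exact ⟨0, 1, 0, 0, by simp⟩
    · exact ⟨0, 0, 1, 0, by simp⟩
  | algebraMap q => exact ⟨q, 0, 0, 0, by simp⟩
  | add x y _ _ hx hy =>
    obtain ⟨a, b, c, d, rfl⟩ := hx
    obtain ⟨a', b', c', d', rfl⟩ := hy
    refine ⟨a + a', b + b', c + c', d + d', ?_⟩
    push_cast
    ring
  | mul x y _ _ hx hy =>
    obtain ⟨a, b, c, d, rfl⟩ := hx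
    obtain ⟨u, v, w, z, rfl⟩ := hy
    refine ⟨a * u + 7 * b * v + s * c * w + 7 * s * d * z,
      a * v + b * u + s * c * z + s * d * w,
      a * w + c * u + 7 * b * z + 7 * d * v,
      a * z + d * u + b * w + c * v, ?_⟩
    push_cast
    generalize Real.sqrt 7 = r at *
    generalize Real.sqrt s = t at *
    linear_combination ((b:ℝ) * v + b * z * t + d * v * t + d * z * t ^ 2) * h7
      + ((c:ℝ) * w + c * z * r + d * w * r + 7 * d * z) * hs

lemma aux_ints (s : ℕ) (hs4 : s % 4 = 3) (hsf : Squarefree s)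
    (hs15 : 15 ≤ s) (h7 : ¬ (7 ∣ s)) (x : ℝ) (hx : x ∈ ringOfInt 7 (s : ℝ)) :
    ∃ U V W T : ℤ, x = ((U : ℝ) + V * Real.sqrt 7 + W * Real.sqrt s
      + T * (Real.sqrt 7 * Real.sqrt s)) / 2 ∧ U % 2 = T % 2 ∧ V % 2 = W % 2 := by
  obtain ⟨hx, hi⟩ := hx
  obtain ⟨u, v, w, z, rfl⟩ := aux_form s x hx
  clear hx
  have hr : Real.sqrt 7 ^ 2 = 7 := Real.sq_sqrt (by norm_num)
  have ht : Real.sqrt s ^ 2 = s := Real.sq_sqrt (by positivity)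
  generalize Real.sqrt 7 = r at *
  generalize Real.sqrt s = t at *
  have hr' : (-r) ^ 2 = 7 := by rw [neg_sq, hr]
  have ht' : (-t) ^ 2 = s := by rw [neg_sq, ht]
  have i2 := aux_conj s hsf hs15 h7 r t hr ht u v w z hi r (-t) hr ht'
  have i3 := aux_conj s hsf hs15 h7 r t hr ht u v w z hi (-r) t hr' ht
  have i4 := aux_conj s hsf hs15 h7 r t hr ht u v w z hi (-r) (-t) hr' ht'
  have h7s : Squarefree 7 := (by norm_num : Nat.Prime 7).prime.squarefree
  obtain ⟨⟨U, hU⟩, ⟨V, hV⟩⟩ := aux_quad 7 h7s (by norm_num) r (by exact_mod_cast hr)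
    (2 * u) (2 * v) (by refine aux_congr (hi.add i2) ?_; push_cast; ring)
    (by refine aux_congr (i3.add i4) ?_; push_cast; ring)
  obtain ⟨-, ⟨W, hW⟩⟩ := aux_quad s hsf hs4 t ht
    (2 * u) (2 * w) (by refine aux_congr (hi.add i3) ?_; push_cast; ring)
    (by refine aux_congr (i2.add i4) ?_; push_cast; ring)
  obtain ⟨N, hN⟩ := aux_int_rat ((2 * u) ^ 2 - (7 * s : ℕ) * (2 * z) ^ 2) (by
    refine aux_congr ((hi.add i4).mul (i2.add i3)) ?_
    push_cast
    linear_combination (4 * (z : ℝ) ^ 2 * t ^ 2) * hr + (28 * (z : ℝ) ^ 2) * ht)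
  obtain ⟨T, hT⟩ := aux_rat_int (7 * s) (aux_sqfree s hsf h7) (2 * z) (U ^ 2 - N) (by
    push_cast
    rw [← hU, ← hN]
    push_cast
    ring)
  obtain ⟨⟨A, hA⟩, ⟨B, hB⟩⟩ := aux_quad 7 h7s (by norm_num) r (by exact_mod_cast hr)
    (u ^ 2 + 7 * v ^ 2 - s * w ^ 2 - 7 * s * z ^ 2) (2 * u * v - 2 * s * w * z)
    (by
      refine aux_congr (hi.mul i2) ?_
      push_cast
      linear_combination (-(v : ℝ) ^ 2 + z ^ 2 * t ^ 2) * hr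
        + ((w : ℝ) ^ 2 + 2 * w * z * r + 7 * z ^ 2) * ht)
    (by
      refine aux_congr (i3.mul i4) ?_
      push_cast
      linear_combination (-(v : ℝ) ^ 2 + z ^ 2 * t ^ 2) * hr
        + ((w : ℝ) ^ 2 - 2 * w * z * r + 7 * z ^ 2) * ht)
  have e1 : U ^ 2 + 7 * V ^ 2 - s * W ^ 2 - 7 * s * T ^ 2 = 4 * A := by
    have : (U : ℚ) ^ 2 + 7 * V ^ 2 - s * W ^ 2 - 7 * s * T ^ 2 = 4 * A := by
      rw [← hU, ← hV, ← hW, ← hT, ← hA]; ring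
    exact_mod_cast this
  have e2 : U * V - s * W * T = 2 * B := by
    have : (U : ℚ) * V - s * W * T = 2 * B := by
      rw [← hU, ← hV, ← hW, ← hT, ← hB]; ring
    exact_mod_cast this
  refine ⟨U, V, W, T, ?_, ?_⟩
  · have hU' : (U : ℝ) = 2 * u := by exact_mod_cast hU.symm
    have hV' : (V : ℝ) = 2 * v := by exact_mod_cast hV.symm
    have hW' : (W : ℝ) = 2 * w := by exact_mod_cast hW.symm
    have hT' : (T : ℝ) = 2 * z := by exact_mod_cast hT.symm
    rw [hU', hV', hW', hT']
    ring
  · obtain ⟨d', hd'⟩ : ∃ d' : ℤ, (s : ℤ) = 4 * d' + 3 := ⟨s / 4, by omega⟩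
    rw [hd'] at e1 e2
    have e3 : U ^ 2 - V ^ 2 + W ^ 2 - T ^ 2 =
        4 * (A - 2 * V ^ 2 + d' * W ^ 2 + W ^ 2 + 7 * d' * T ^ 2 + 5 * T ^ 2) := by
      linear_combination e1
    have e4 : U * V - W * T = 2 * (B + 2 * d' * W * T + W * T) := by
      linear_combination e2
    clear e1 e2 hA hB hU hV hW hT hN
    generalize A - 2 * V ^ 2 + d' * W ^ 2 + W ^ 2 + 7 * d' * T ^ 2 + 5 * T ^ 2 = y at e3
    generalize B + 2 * d' * W * T + W * T = y' at e4
    rcases Int.even_or_odd' U with ⟨m', rfl | rfl⟩ <;>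
    rcases Int.even_or_odd' V with ⟨k', rfl | rfl⟩ <;>
    rcases Int.even_or_odd' W with ⟨l', rfl | rfl⟩ <;>
    rcases Int.even_or_odd' T with ⟨n', rfl | rfl⟩ <;>
      ring_nf at e3 e4 <;> constructor <;> omega

lemma aux_peel {n : ℕ} (S : Finset (Fin n)) (f : Fin n → ℤ) (c : ℤ) (hc : 0 < c)
    (h : ∑ i ∈ S, f i ^ 2 = c) :
    ∃ i ∈ S, f i ≠ 0 ∧ f i ^ 2 ≤ c := by
  obtain ⟨i, hi, hf⟩ : ∃ i ∈ S, f i ≠ 0 := by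
    by_contra! hh
    rw [Finset.sum_eq_zero (fun i hi => by rw [hh i hi]; norm_num)] at h
    omega
  refine ⟨i, hi, hf, ?_⟩
  rw [← h]
  exact Finset.single_le_sum (f := fun i => f i ^ 2) (fun j _ => sq_nonneg _) hi

lemma aux_zero {n : ℕ} (S : Finset (Fin n)) (f : Fin n → ℤ)
    (h : ∑ i ∈ S, f i ^ 2 = 0) : ∀ i ∈ S, f i = 0 := by
  intro i hi
  have := (Finset.sum_eq_zero_iff_of_nonneg (fun j _ => sq_nonneg (f j))).1 h i hi
  simpa using this

lemma aux_er {n : ℕ} (S : Finset (Fin n)) (f : Fin n → ℤ) (i : Fin n) (hi : i ∈ S) :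
    ∑ j ∈ S, f j = f i + ∑ j ∈ S.erase i, f j := (Finset.add_sum_erase S f hi).symm

lemma aux_ms {n : ℕ} (S : Finset (Fin n)) (g : Fin n → ℝ) (i : Fin n) (hi : i ∈ S)
    (hg : g i ≠ 0) : ((S.val.map g).filter fun r => r ≠ 0)
      = g i ::ₘ (((S.erase i).val.map g).filter fun r => r ≠ 0) := by
  have h : S.val = i ::ₘ (S.erase i).val := by
    rw [Finset.erase_val]
    exact (Multiset.cons_erase hi).symm
  rw [h, Multiset.map_cons, Multiset.filter_cons_of_pos (p := fun r : ℝ => r ≠ 0) _ hg]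

lemma aux_ms0 {n : ℕ} (S : Finset (Fin n)) (g : Fin n → ℝ) (h : ∀ i ∈ S, g i = 0) :
    ((S.val.map g).filter fun r => r ≠ 0) = 0 := by
  rw [Multiset.filter_eq_nil]
  intro r hr
  obtain ⟨i, hi, rfl⟩ := Multiset.mem_map.1 hr
  simpa using h i hi

lemma aux_pm (a : ℤ) (h0 : a ≠ 0) (h : a ^ 2 < 4) : a = 1 ∨ a = -1 := by
  have h1 : a < 2 := by nlinarith
  have h2 : -2 < a := by nlinarith
  omega

lemma aux_lt3 (a : ℤ) (h : a ^ 2 < 9) : -3 < a ∧ a < 3 := by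
  constructor <;> nlinarith

lemma aux_wv (a b c d : ℤ) (ha : a = 1 ∨ a = -1) (hb : b = 1 ∨ b = -1) (hc : c = 1 ∨ c = -1)
    (hd : d = 1 ∨ d = -1) (h : a * c + b * d = 2) : a = c ∧ b = d := by
  rcases ha with rfl | rfl <;> rcases hb with rfl | rfl <;> rcases hc with rfl | rfl <;>
    rcases hd with rfl | rfl <;> first | exact ⟨rfl, rfl⟩ | (exfalso; norm_num at h)

lemma aux_case (a b : ℤ) (h : a + b = 1) (h' : a ^ 2 + b ^ 2 ≤ 4) :
    (a = 0 ∧ b = 1) ∨ (a = 1 ∧ b = 0) := by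
  have hb : b = 1 - a := by linarith
  subst hb
  have h1 : a < 2 := by nlinarith
  have h2 : -1 < a := by nlinarith
  omega

lemma aux_sq1 (a v : ℤ) (h : a * v = 2) (hv : v ^ 2 = 4) : a ^ 2 = 1 := by
  have : (a * v) ^ 2 = 4 := by rw [h]; norm_num
  rw [mul_pow, hv] at this
  linarith

/-- The combinatorial part: three ones on a set. -/
lemma aux_ones {n : ℕ} (S : Finset (Fin n)) (A : Fin n → ℤ) (g : Fin n → ℝ)
    (hg : ∀ i ∈ S, g i = (A i : ℝ) ^ 2) (h : ∑ i ∈ S, A i ^ 2 = 3) :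
    ((S.val.map g).filter fun r => r ≠ 0) = {1, 1, 1} := by
  obtain ⟨i, hi, hi0, hile⟩ := aux_peel S A 3 (by norm_num) h
  have hi1 : A i ^ 2 = 1 := by
    rcases aux_pm _ hi0 (by linarith) with h | h <;> rw [h] <;> norm_num
  rw [aux_er S _ i hi] at h
  obtain ⟨j, hj, hj0, hjle⟩ := aux_peel (S.erase i) A 2 (by norm_num) (by linarith)
  have hj1 : A j ^ 2 = 1 := by
    rcases aux_pm _ hj0 (by linarith) with h | h <;> rw [h] <;> norm_num
  rw [aux_er _ _ j hj] at h
  obtain ⟨k, hk, hk0, hkle⟩ := aux_peel ((S.erase i).erase j) A 1 (by norm_num) (by linarith)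
  have hk1 : A k ^ 2 = 1 := by
    rcases aux_pm _ hk0 (by linarith) with h | h <;> rw [h] <;> norm_num
  rw [aux_er _ _ k hk] at h
  have hz := aux_zero (((S.erase i).erase j).erase k) A (by linarith)
  have gi : g i = 1 := by rw [hg i hi]; exact_mod_cast hi1
  have gj : g j = 1 := by rw [hg j (Finset.mem_of_mem_erase hj)]; exact_mod_cast hj1
  have gk : g k = 1 := by
    rw [hg k (Finset.mem_of_mem_erase (Finset.mem_of_mem_erase hk))]; exact_mod_cast hk1
  rw [aux_ms S g i hi (by rw [gi]; norm_num), aux_ms _ g j hj (by rw [gj]; norm_num),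
    aux_ms _ g k hk (by rw [gk]; norm_num), aux_ms0 _ g, gi, gj, gk]
  · rfl
  · intro l hl
    rw [hg l, hz l hl]
    · norm_num
    · exact Finset.mem_of_mem_erase (Finset.mem_of_mem_erase (Finset.mem_of_mem_erase hl))

lemma aux_cs {n : ℕ} (S : Finset (Fin n)) (A V : Fin n → ℤ) :
    (∑ i ∈ S, A i * V i) ^ 2 ≤ (∑ i ∈ S, A i ^ 2) * ∑ i ∈ S, V i ^ 2 :=
  Finset.sum_mul_sq_le_sq_mul_sq S A V

set_option maxHeartbeats 1000000 in
lemma aux_comb {n : ℕ} (s : ℕ) (hs15 : 15 ≤ s) (hs4 : s % 4 = 3) (A V W : Fin n → ℤ) (x : Fin n → ℝ)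
    (r t : ℝ) (hr : 0 < r) (ht : 0 < t)
    (hx : ∀ i, x i = A i + (V i * r + W i * t) / 2)
    (hp : ∀ i, V i % 2 = W i % 2)
    (h1 : 4 * ∑ i, A i ^ 2 + 7 * ∑ i, V i ^ 2 + s * ∑ i, W i ^ 2 = 62 + 2 * s)
    (h2 : ∑ i, A i * V i = 3) (h3 : ∑ i, A i * W i = 1) (h4 : ∑ i, V i * W i = 2) :
    ((Finset.univ.val.map fun i => x i ^ 2).filter fun y => y ≠ 0)
      = ({(1 + (r + t) / 2) ^ 2, ((r + t) / 2) ^ 2, (1 + r) ^ 2, 1, 1, 1} : Multiset ℝ) := by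
  have csAV := aux_cs Finset.univ A V
  have csAW := aux_cs Finset.univ A W
  have csVW := aux_cs Finset.univ V W
  have evenW : (∑ i, W i ^ 2) % 2 = 0 := by
    have : (∑ i, W i ^ 2) % 2 = (∑ i, V i * W i) % 2 := by
      apply Int.ModEq.sum
      intro i _
      have : W i ≡ V i [ZMOD 2] := (hp i).symm
      rw [sq]
      exact this.mul_right _
    rw [this, h4]; rfl
  have nA : 0 ≤ ∑ i, A i ^ 2 := Finset.sum_nonneg fun i _ => sq_nonneg _
  have nV : 0 ≤ ∑ i, V i ^ 2 := Finset.sum_nonneg fun i _ => sq_nonneg _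
  have nW : 0 ≤ ∑ i, W i ^ 2 := Finset.sum_nonneg fun i _ => sq_nonneg _
  rw [h2] at csAV
  rw [h3] at csAW
  rw [h4] at csVW
  have hW2 : ∑ i, W i ^ 2 = 2 := by
    generalize ∑ i, W i ^ 2 = w at *
    generalize ∑ i, A i ^ 2 = a at *
    generalize ∑ i, V i ^ 2 = v at *
    have hs : (15 : ℤ) ≤ s := by exact_mod_cast hs15
    have hwpos : w ≠ 0 := by rintro rfl; norm_num at csAW
    have hav : 1 ≤ a := by nlinarith
    have hvv : 1 ≤ v := by nlinarith
    by_contra hne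
    have hw4 : 4 ≤ w := by omega
    have hle : w ≤ 4 := by
      by_contra hw
      have : 6 ≤ w := by omega
      nlinarith
    have hw : w = 4 := le_antisymm hle hw4
    subst hw
    have hle : 4 * a + 7 * v ≤ 32 := by linarith
    have hv5 : v ≤ 4 := by omega
    have ha : a ≤ 7 := by omega
    have e : 4 * a + 7 * v = 62 - 2 * s := by linarith
    have : (s : ℤ) % 4 = 3 := by omega
    interval_cases v <;> interval_cases a <;> omega
  rw [hW2] at h1
  clear csAV csAW csVW evenW nW
  have hV26 : ∑ i, V i ^ 2 = 2 ∨ ∑ i, V i ^ 2 = 6 := by omega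
  obtain ⟨i, hi, hi0, hile⟩ := aux_peel Finset.univ W 2 (by norm_num) hW2
  have hi1 := aux_pm _ hi0 (by linarith)
  have hi2 : W i ^ 2 = 1 := by rcases hi1 with h | h <;> rw [h] <;> norm_num
  rw [aux_er _ _ i hi] at hW2
  obtain ⟨j, hj, hj0, hjle⟩ := aux_peel (Finset.univ.erase i) W 1 (by norm_num) (by linarith)
  have hj1 := aux_pm _ hj0 (by linarith)
  have hj2 : W j ^ 2 = 1 := by rcases hj1 with h | h <;> rw [h] <;> norm_num
  rw [aux_er _ _ j hj] at hW2
  have hz := aux_zero _ W (by linarith : ∑ k ∈ (Finset.univ.erase i).erase j, W k ^ 2 = 0)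
  have h1' : 4 * ∑ i, A i ^ 2 + 7 * ∑ i, V i ^ 2 = 62 := by linarith
  clear h1
  rw [aux_er _ _ i hi, aux_er _ _ j hj] at h3 h4 h2
  rw [Finset.sum_eq_zero (fun k hk => by rw [hz k hk, mul_zero])] at h3 h4
  set S := (Finset.univ.erase i).erase j with hS
  have eV : ∑ i, V i ^ 2 = V i ^ 2 + (V j ^ 2 + ∑ k ∈ S, V k ^ 2) := by
    rw [aux_er _ _ i hi, aux_er _ _ j hj]
  have eA : ∑ i, A i ^ 2 = A i ^ 2 + (A j ^ 2 + ∑ k ∈ S, A k ^ 2) := by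
    rw [aux_er _ _ i hi, aux_er _ _ j hj]
  have nVS : 0 ≤ ∑ k ∈ S, V k ^ 2 := Finset.sum_nonneg fun i _ => sq_nonneg _
  have nAS : 0 ≤ ∑ k ∈ S, A k ^ 2 := Finset.sum_nonneg fun i _ => sq_nonneg _
  have oi : V i % 2 = 1 := by rw [hp i]; rcases hi1 with h | h <;> rw [h] <;> rfl
  have oj : V j % 2 = 1 := by rw [hp j]; rcases hj1 with h | h <;> rw [h] <;> rfl
  have bi : V i ^ 2 ≤ 6 := by
    have := sq_nonneg (V j)
    rcases hV26 with h | h <;> linarith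
  have bj : V j ^ 2 ≤ 6 := by
    have := sq_nonneg (V i)
    rcases hV26 with h | h <;> linarith
  have pi : V i = 1 ∨ V i = -1 := by
    have := aux_lt3 (V i) (by linarith)
    omega
  have pj : V j = 1 ∨ V j = -1 := by
    have := aux_lt3 (V j) (by linarith)
    omega
  have qi : V i ^ 2 = 1 := by rcases pi with h | h <;> rw [h] <;> norm_num
  have qj : V j ^ 2 = 1 := by rcases pj with h | h <;> rw [h] <;> norm_num
  have wv := aux_wv _ _ _ _ pi pj hi1 hj1 (by linarith)
  obtain ⟨wi, wj⟩ := wv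
  rw [wi, wj] at h2
  have h2' : ∑ k ∈ S, A k * V k = 2 := by linarith
  have hV6 : ∑ k ∈ S, V k ^ 2 = 4 := by
    rcases hV26 with h | h
    · exfalso
      have := aux_zero S V (by linarith)
      rw [Finset.sum_eq_zero (fun k hk => by rw [this k hk, mul_zero])] at h2'
      norm_num at h2'
    · linarith
  have hV6' : ∑ i, V i ^ 2 = 6 := by linarith
  obtain ⟨k, hk, hk0, hkle⟩ := aux_peel S V 4 (by norm_num) hV6
  have hkp : V k = 2 ∨ V k = -2 := by
    have := aux_lt3 (V k) (by linarith)
    have h3 := hp k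
    rw [hz k hk] at h3
    omega
  have hk2 : V k ^ 2 = 4 := by rcases hkp with h | h <;> rw [h] <;> norm_num
  rw [aux_er _ _ k hk] at hV6
  have hzV := aux_zero _ V (by linarith : ∑ l ∈ S.erase k, V l ^ 2 = 0)
  rw [aux_er _ _ k hk, Finset.sum_eq_zero (fun l hl => by rw [hzV l hl, mul_zero])] at h2'
  have hAk : A k * V k = 2 := by linarith
  have qk : A k ^ 2 = 1 := aux_sq1 _ _ hAk hk2
  rw [aux_er _ _ k hk] at eA nAS
  have nAS' : 0 ≤ ∑ l ∈ S.erase k, A l ^ 2 := Finset.sum_nonneg fun i _ => sq_nonneg _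
  have hA5 : A i ^ 2 + A j ^ 2 + ∑ l ∈ S.erase k, A l ^ 2 = 4 := by linarith
  have pai : (A i * W i) ^ 2 = A i ^ 2 := by rw [mul_pow, hi2, mul_one]
  have paj : (A j * W j) ^ 2 = A j ^ 2 := by rw [mul_pow, hj2, mul_one]
  have xi : x i ^ 2 = (((A i * W i : ℤ) : ℝ) + (r + t) / 2) ^ 2 := by
    rw [hx i, wi]
    rcases hi1 with h | h <;> rw [h] <;> push_cast <;> ring
  have xj : x j ^ 2 = (((A j * W j : ℤ) : ℝ) + (r + t) / 2) ^ 2 := by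
    rw [hx j, wj]
    rcases hj1 with h | h <;> rw [h] <;> push_cast <;> ring
  have xk : x k ^ 2 = (1 + r) ^ 2 := by
    rw [hx k, hz k hk]
    rcases hkp with h | h <;> rw [h] at hAk ⊢
    · have : A k = 1 := by linarith
      rw [this]; push_cast; ring
    · have : A k = -1 := by linarith
      rw [this]; push_cast; ring
  rw [← pai, ← paj] at hA5
  have hcase := aux_case (A i * W i) (A j * W j) (by linarith) (by linarith)
  have h3' : ∑ l ∈ S.erase k, A l ^ 2 = 3 := by
    rcases hcase with ⟨h, h'⟩ | ⟨h, h'⟩ <;> rw [h, h'] at hA5 <;> linarith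
  have hones := aux_ones (S.erase k) A (fun i => x i ^ 2) (by
    intro l hl
    show x l ^ 2 = _
    rw [hx l, hzV l hl, hz l (Finset.mem_of_mem_erase hl)]
    push_cast
    ring) h3'
  have n1 : (1 + (r + t) / 2) ^ 2 ≠ 0 := by positivity
  have n2 : ((r + t) / 2) ^ 2 ≠ 0 := by positivity
  have n3 : (1 + r) ^ 2 ≠ 0 := by positivity
  rcases hcase with ⟨h, h'⟩ | ⟨h, h'⟩
  · rw [h, Int.cast_zero, zero_add] at xi
    rw [h', Int.cast_one] at xj
    rw [aux_ms _ (fun i => x i ^ 2) i hi (by rw [xi]; exact n2),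
      aux_ms _ (fun i => x i ^ 2) j hj (by rw [xj]; exact n1),
      aux_ms _ (fun i => x i ^ 2) k hk (by rw [xk]; exact n3), hones, Multiset.cons_swap, xi, xj, xk]
    rfl
  · rw [h, Int.cast_one] at xi
    rw [h', Int.cast_zero, zero_add] at xj
    rw [aux_ms _ (fun i => x i ^ 2) i hi (by rw [xi]; exact n1),
      aux_ms _ (fun i => x i ^ 2) j hj (by rw [xj]; exact n2),
      aux_ms _ (fun i => x i ^ 2) k hk (by rw [xk]; exact n3), hones, xi, xj, xk]
    rfl

lemma aux_main (s : ℕ) (hs4 : s % 4 = 3) (hsf : Squarefree s)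
    (hs15 : 15 ≤ s) (h7 : ¬ (7 ∣ s)) (n : ℕ) (x : Fin n → ℝ)
    (hx : ∀ i, x i ∈ ringOfInt 7 (s : ℝ))
    (h : (1 : ℝ) ^ 2 + 1 ^ 2 + 1 ^ 2 + (1 + Real.sqrt 7) ^ 2
          + ((Real.sqrt 7 + Real.sqrt s) / 2) ^ 2
          + (1 + (Real.sqrt 7 + Real.sqrt s) / 2) ^ 2 = ∑ i, x i ^ 2) :
    ((Finset.univ.val.map fun i => x i ^ 2).filter fun r => r ≠ 0)
        = ({(1 + (Real.sqrt 7 + Real.sqrt s) / 2) ^ 2,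
            ((Real.sqrt 7 + Real.sqrt s) / 2) ^ 2,
            (1 + Real.sqrt 7) ^ 2, 1, 1, 1} : Multiset ℝ) := by
  choose U V W T hxe hUT hVW using fun i => aux_ints s hs4 hsf hs15 h7 (x i) (hx i)
  have hr : Real.sqrt 7 ^ 2 = 7 := Real.sq_sqrt (by norm_num)
  have ht : Real.sqrt s ^ 2 = s := Real.sq_sqrt (by positivity)
  have hr0 : 0 < Real.sqrt 7 := Real.sqrt_pos.2 (by norm_num)
  have ht0 : 0 < Real.sqrt s := Real.sqrt_pos.2 (by
    have : 0 < s := by omega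
    exact_mod_cast this)
  clear hx
  generalize Real.sqrt 7 = r at *
  generalize Real.sqrt s = t at *
  have hsum : 4 * ∑ i, x i ^ 2 = ((∑ i, (U i ^ 2 + 7 * V i ^ 2 + s * W i ^ 2 + 7 * s * T i ^ 2) : ℤ) : ℝ)
      + ((∑ i, (2 * (U i * V i + s * (W i * T i))) : ℤ) : ℝ) * r
      + ((∑ i, (2 * (U i * W i + 7 * (V i * T i))) : ℤ) : ℝ) * t
      + ((∑ i, (2 * (U i * T i + V i * W i)) : ℤ) : ℝ) * (r * t) := by
    push_cast
    rw [Finset.mul_sum, Finset.sum_mul, Finset.sum_mul, Finset.sum_mul, ← Finset.sum_add_distrib,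
      ← Finset.sum_add_distrib, ← Finset.sum_add_distrib]
    apply Finset.sum_congr rfl
    intro i _
    rw [hxe i]
    linear_combination ((V i : ℝ) ^ 2 + 2 * V i * T i * t + T i ^ 2 * t ^ 2) * hr
      + ((W i : ℝ) ^ 2 + 2 * W i * T i * r + 7 * T i ^ 2) * ht
  rw [← h] at hsum
  obtain ⟨e1, e2, e3, e4⟩ := aux_indep s hsf hs15 h7 r t hr ht
    ((∑ i, (U i ^ 2 + 7 * V i ^ 2 + s * W i ^ 2 + 7 * s * T i ^ 2) - (62 + 2 * s) : ℤ) : ℚ)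
    ((∑ i, (2 * (U i * V i + s * (W i * T i))) - 12 : ℤ) : ℚ)
    ((∑ i, (2 * (U i * W i + 7 * (V i * T i))) - 4 : ℤ) : ℚ)
    ((∑ i, (2 * (U i * T i + V i * W i)) - 4 : ℤ) : ℚ) (by
      rw [Rat.cast_intCast, Rat.cast_intCast, Rat.cast_intCast, Rat.cast_intCast]
      rw [Int.cast_sub, Int.cast_sub, Int.cast_sub, Int.cast_sub]
      have e : ((62 + 2 * (s : ℤ) : ℤ) : ℝ) = 62 + 2 * s := by push_cast; ring
      rw [e]
      generalize ((∑ i, (U i ^ 2 + 7 * V i ^ 2 + s * W i ^ 2 + 7 * s * T i ^ 2) : ℤ) : ℝ) = p1 at *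
      generalize ((∑ i, (2 * (U i * V i + s * (W i * T i))) : ℤ) : ℝ) = p2 at *
      generalize ((∑ i, (2 * (U i * W i + 7 * (V i * T i))) : ℤ) : ℝ) = p3 at *
      generalize ((∑ i, (2 * (U i * T i + V i * W i)) : ℤ) : ℝ) = p4 at *
      push_cast
      linear_combination -hsum + 6 * hr + 2 * ht)
  rw [Int.cast_eq_zero, sub_eq_zero] at e1 e2 e3 e4
  have hs : (15 : ℤ) ≤ s := by exact_mod_cast hs15
  have hT : ∀ i, T i = 0 := by
    by_contra! hh
    obtain ⟨i, hi⟩ := hh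
    have hT1 : 1 ≤ T i ^ 2 := by
      have : 0 < T i ^ 2 := by positivity
      omega
    have : U i ^ 2 + 7 * V i ^ 2 + s * W i ^ 2 + 7 * s * T i ^ 2 ≤ 62 + 2 * s := by
      rw [← e1]
      exact Finset.single_le_sum
        (f := fun i => U i ^ 2 + 7 * V i ^ 2 + s * W i ^ 2 + 7 * s * T i ^ 2)
        (fun j _ => by positivity) (Finset.mem_univ i)
    have h1 : 0 ≤ U i ^ 2 + 7 * V i ^ 2 + s * W i ^ 2 := by positivity
    nlinarith
  have hU : ∀ i, ∃ a, U i = 2 * a := by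
    intro i
    have := hUT i
    rw [hT i] at this
    exact ⟨U i / 2, by omega⟩
  choose A hA using hU
  simp only [hA, hT] at e1 e2 e3 e4 hxe
  apply aux_comb s hs15 hs4 A V W x r t hr0 ht0
  · intro i
    rw [hxe i]
    push_cast
    ring
  · exact hVW
  · rw [← e1, Finset.mul_sum, Finset.mul_sum, Finset.mul_sum, ← Finset.sum_add_distrib,
      ← Finset.sum_add_distrib]
    apply Finset.sum_congr rfl
    intro i _
    ring
  · have : ∑ i, 2 * (2 * A i * V i + s * (W i * 0)) = 4 * ∑ i, A i * V i := by
      rw [Finset.mul_sum]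
      exact Finset.sum_congr rfl fun i _ => by ring
    linarith
  · have : ∑ i, 2 * (2 * A i * W i + 7 * (V i * 0)) = 4 * ∑ i, A i * W i := by
      rw [Finset.mul_sum]
      exact Finset.sum_congr rfl fun i _ => by ring
    linarith
  · have : ∑ i, 2 * (2 * A i * 0 + V i * W i) = 2 * ∑ i, V i * W i := by
      rw [Finset.mul_sum]
      exact Finset.sum_congr rfl fun i _ => by ring
    linarith

theorem m7_s3_unique_rep (s : ℕ) (hs4 : s % 4 = 3) (hsf : Squarefree s)
    (hs15 : 15 ≤ s) (h7 : ¬ (7 ∣ s)) :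
    (¬ ∃ n : ℕ, n < 6 ∧ SumOfSquaresLen (ringOfInt 7 (s : ℝ)) n
        ((1 : ℝ) ^ 2 + 1 ^ 2 + 1 ^ 2 + (1 + Real.sqrt 7) ^ 2
          + ((Real.sqrt 7 + Real.sqrt s) / 2) ^ 2
          + (1 + (Real.sqrt 7 + Real.sqrt s) / 2) ^ 2)) ∧
    (∀ (n : ℕ) (x : Fin n → ℝ), (∀ i, x i ∈ ringOfInt 7 (s : ℝ)) →
      (1 : ℝ) ^ 2 + 1 ^ 2 + 1 ^ 2 + (1 + Real.sqrt 7) ^ 2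
          + ((Real.sqrt 7 + Real.sqrt s) / 2) ^ 2
          + (1 + (Real.sqrt 7 + Real.sqrt s) / 2) ^ 2 = ∑ i, x i ^ 2 →
      ((Finset.univ.val.map fun i => x i ^ 2).filter fun r => r ≠ 0)
        = ({(1 + (Real.sqrt 7 + Real.sqrt s) / 2) ^ 2,
            ((Real.sqrt 7 + Real.sqrt s) / 2) ^ 2,
            (1 + Real.sqrt 7) ^ 2, 1, 1, 1} : Multiset ℝ)) := by
  refine ⟨?_, fun n x hx h => aux_main s hs4 hsf hs15 h7 n x hx h⟩
  rintro ⟨n, hn, x, hx, h⟩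
  have hm := congrArg Multiset.card (aux_main s hs4 hsf hs15 h7 n x hx h)
  have hle := Multiset.card_le_card (Multiset.filter_le (fun r : ℝ => r ≠ 0)
    (Finset.univ.val.map fun i => x i ^ 2))
  rw [hm] at hle
  simp at hle
  omega
end
end
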